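/- arXiv:1010.3433 — 6 statements merged into one kernel-verified Lean document; each statement's English description precedes it below -/
import Mathlib

section
/- There exists a constant C > 0 such that for every M > 1, every real t ≠ 0 and all x, y ∈ ℝ, one has |∫_ℝ e^{itλ²} λ χ(λ/M) K_λ(x,y) dλ| ≤ C |t|^{-1/2}. -/
open MeasureTheory Complex

/-- The function `ρ₊(λ)`: `(λ²−1)^{1/2}` for `λ > 1`, `i(1−λ²)^{1/2}` for `−1 ≤ λ ≤ 1`,
`−(λ²−1)^{1/2}` for `λ < −1`. -/
noncomputable def rhoPlus (l : ℝ) : ℂ :=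
  if 1 < l then (Real.sqrt (l ^ 2 - 1) : ℂ)
  else if l < -1 then -(Real.sqrt (l ^ 2 - 1) : ℂ)
  else Complex.I * (Real.sqrt (1 - l ^ 2) : ℂ)

/-- The kernel `K_λ(x,y)` for `y ≤ x` (the three regions `y<x<0`, `y<0<x`, `0<y<x`). -/
noncomputable def Kaux (l x y : ℝ) : ℂ :=
  if x < 0 then
    1 / (2 * Complex.I * (l : ℂ)) * Complex.exp (Complex.I * (l : ℂ) * ((x : ℂ) - (y : ℂ)))
      + 1 / (2 * Complex.I * (l : ℂ)) * (((l : ℂ) - rhoPlus l) / ((l : ℂ) + rhoPlus l))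
          * Complex.exp (-(Complex.I * (l : ℂ) * ((x : ℂ) + (y : ℂ))))
  else if 0 < y then
    1 / (2 * Complex.I * rhoPlus l) * (((l : ℂ) - rhoPlus l) / ((l : ℂ) + rhoPlus l))
        * Complex.exp (Complex.I * rhoPlus l * ((x : ℂ) + (y : ℂ)))
      + 1 / (2 * Complex.I * rhoPlus l)
          * Complex.exp (Complex.I * rhoPlus l * ((x : ℂ) - (y : ℂ)))
  else
    1 / (Complex.I * (rhoPlus l + (l : ℂ))) * Complex.exp (Complex.I * rhoPlus l * (x : ℂ))
      * Complex.exp (-(Complex.I * (l : ℂ) * (y : ℂ)))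

/-- The symmetric kernel `K_λ(x,y) = K_λ(y,x)`. -/
noncomputable def Kker (l x y : ℝ) : ℂ :=
  if y ≤ x then Kaux l x y else Kaux l y x

section Oscillatory

open Set

/-- `g` is continuous on `(a, b)` and its integrals over compact subintervals are bounded by `B`. -/
def OscBound (a b B : ℝ) (g : ℝ → ℂ) : Prop :=
  ContinuousOn g (Ioo a b) ∧ ∀ c ∈ Ioo a b, ∀ d ∈ Ioo a b, ‖∫ s in c..d, g s‖ ≤ B

lemma uIcc_subset_Ioo_of_mem {a b c d : ℝ} (hc : c ∈ Ioo a b) (hd : d ∈ Ioo a b) :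
    uIcc c d ⊆ Ioo a b :=
  ordConnected_Ioo.uIcc_subset hc hd

namespace OscBound

variable {a b B : ℝ} {g : ℝ → ℂ}

lemma of_le (hg : ContinuousOn g (Ioo a b))
    (h : ∀ c ∈ Ioo a b, ∀ d ∈ Ioo a b, c ≤ d → ‖∫ s in c..d, g s‖ ≤ B) : OscBound a b B g := by
  refine ⟨hg, fun c hc d hd => ?_⟩
  rcases le_total c d with hcd | hcd
  · exact h c hc d hd hcd
  · rw [intervalIntegral.integral_symm, norm_neg]
    exact h d hd c hc hcd

lemma intervalIntegrable (h : OscBound a b B g) {c d : ℝ} (hc : c ∈ Ioo a b) (hd : d ∈ Ioo a b) :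
    IntervalIntegrable g volume c d :=
  (h.1.mono (uIcc_subset_Ioo_of_mem hc hd)).intervalIntegrable

lemma mono (h : OscBound a b B g) {B' : ℝ} (hB : B ≤ B') : OscBound a b B' g :=
  ⟨h.1, fun c hc d hd => (h.2 c hc d hd).trans hB⟩

lemma congr (h : OscBound a b B g) {g' : ℝ → ℂ} (hg : ∀ s ∈ Ioo a b, g' s = g s) :
    OscBound a b B g' := by
  refine ⟨h.1.congr hg, fun c hc d hd => ?_⟩
  rw [intervalIntegral.integral_congr fun s hs => hg s (uIcc_subset_Ioo_of_mem hc hd hs)]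
  exact h.2 c hc d hd

lemma add (h : OscBound a b B g) {B' : ℝ} {g' : ℝ → ℂ} (h' : OscBound a b B' g') :
    OscBound a b (B + B') (fun s => g s + g' s) := by
  refine ⟨h.1.add h'.1, fun c hc d hd => ?_⟩
  rw [intervalIntegral.integral_add (h.intervalIntegrable hc hd) (h'.intervalIntegrable hc hd)]
  exact (norm_add_le _ _).trans (add_le_add (h.2 c hc d hd) (h'.2 c hc d hd))

lemma const_mul (h : OscBound a b B g) (z : ℂ) : OscBound a b (‖z‖ * B) (fun s => z * g s) := by
  refine ⟨h.1.const_mul z, fun c hc d hd => ?_⟩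
  rw [intervalIntegral.integral_const_mul, norm_mul]
  exact mul_le_mul_of_nonneg_left (h.2 c hc d hd) (norm_nonneg _)

lemma conj (h : OscBound a b B g) : OscBound a b B (fun s => (starRingEnd ℂ) (g s)) := by
  refine of_le (Complex.continuous_conj.comp_continuousOn h.1) fun c hc d hd hcd => ?_
  have := h.2 c hc d hd
  rw [intervalIntegral.integral_of_le hcd] at this ⊢
  rwa [integral_conj, RCLike.norm_conj]

/-- Multiplication by a real `C¹` function of bounded variation. -/
lemma mul_ofReal (h : OscBound a b B g) {f f' : ℝ → ℝ} {K V : ℝ}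
    (hf : ∀ s ∈ Ioo a b, HasDerivAt f (f' s) s) (hf' : ContinuousOn f' (Ioo a b))
    (hK : ∀ s ∈ Ioo a b, |f s| ≤ K)
    (hV : ∀ c ∈ Ioo a b, ∀ d ∈ Ioo a b, c ≤ d → ∫ s in c..d, |f' s| ≤ V) :
    OscBound a b ((K + V) * B) (fun s => (f s : ℂ) * g s) := by
  refine of_le (ContinuousOn.mul (Complex.continuous_ofReal.comp_continuousOn
    fun s hs => (hf s hs).continuousAt.continuousWithinAt) h.1) fun c hc d hd hcd => ?_
  have hsub := uIcc_subset_Ioo_of_mem hc hd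
  have hB : 0 ≤ B := (norm_nonneg _).trans (h.2 c hc d hd)
  have hG : ∀ s ∈ Ioo a b, HasDerivAt (fun u => ∫ r in c..u, g r) (g s) s := fun s hs =>
    intervalIntegral.integral_hasDerivAt_right (h.intervalIntegrable hc hs)
      (h.1.stronglyMeasurableAtFilter isOpen_Ioo s hs) (h.1.continuousAt (isOpen_Ioo.mem_nhds hs))
  have hfi : IntervalIntegrable f' volume c d := (hf'.mono hsub).intervalIntegrable
  have key := intervalIntegral.integral_mul_deriv_eq_deriv_mul (a := c) (b := d)
    (u := fun s => (f s : ℂ)) (u' := fun s => (f' s : ℂ)) (v := fun u => ∫ r in c..u, g r) (v' := g)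
    (fun s hs => (hf s (hsub hs)).ofReal_comp) (fun s hs => hG s (hsub hs))
    ((Complex.continuous_ofReal.comp_continuousOn hf').mono hsub).intervalIntegrable
    (h.intervalIntegrable hc hd)
  rw [key, intervalIntegral.integral_same, mul_zero, sub_zero]
  have h1 : ‖(f d : ℂ) * ∫ r in c..d, g r‖ ≤ K * B := by
    rw [norm_mul, Complex.norm_real]
    exact mul_le_mul (hK d hd) (h.2 c hc d hd) (norm_nonneg _) ((abs_nonneg _).trans (hK d hd))
  have h2 : ‖∫ s in c..d, (f' s : ℂ) * ∫ r in c..s, g r‖ ≤ V * B := by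
    calc _ ≤ ∫ s in c..d, |f' s| * B := by
          refine intervalIntegral.norm_integral_le_of_norm_le hcd ?_ (hfi.abs.mul_const B)
          refine Filter.Eventually.of_forall fun s hs => ?_
          rw [norm_mul, Complex.norm_real]
          exact mul_le_mul_of_nonneg_left
            (h.2 c hc s (hsub (Ioc_subset_Icc_self.trans Icc_subset_uIcc hs))) (norm_nonneg _)
      _ = (∫ s in c..d, |f' s|) * B := intervalIntegral.integral_mul_const _ _
      _ ≤ V * B := mul_le_mul_of_nonneg_right (hV c hc d hd hcd) hB
  calc _ ≤ K * B + V * B := (norm_sub_le _ _).trans (add_le_add h1 h2)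
    _ = _ := by ring

lemma mul_monotone (h : OscBound a b B g) {f f' : ℝ → ℝ} {K : ℝ}
    (hf : ∀ s ∈ Ioo a b, HasDerivAt f (f' s) s) (hf' : ContinuousOn f' (Ioo a b))
    (h0 : ∀ s ∈ Ioo a b, 0 ≤ f' s) (hK : ∀ s ∈ Ioo a b, 0 ≤ f s ∧ f s ≤ K) :
    OscBound a b (2 * K * B) (fun s => (f s : ℂ) * g s) := by
  rw [two_mul]
  refine h.mul_ofReal hf hf' (fun s hs => abs_le.2 ⟨?_, (hK s hs).2⟩) fun c hc d hd hcd => ?_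
  · linarith [hK s hs]
  · have hsub := uIcc_subset_Ioo_of_mem hc hd
    rw [intervalIntegral.integral_congr fun s hs => abs_of_nonneg (h0 s (hsub hs)),
      intervalIntegral.integral_eq_sub_of_hasDerivAt (fun s hs => hf s (hsub hs))
        (hf'.mono hsub).intervalIntegrable]
    linarith [hK c hc, hK d hd]

lemma mul_antitone (h : OscBound a b B g) {f f' : ℝ → ℝ} {K : ℝ}
    (hf : ∀ s ∈ Ioo a b, HasDerivAt f (f' s) s) (hf' : ContinuousOn f' (Ioo a b))
    (h0 : ∀ s ∈ Ioo a b, f' s ≤ 0) (hK : ∀ s ∈ Ioo a b, 0 ≤ f s ∧ f s ≤ K) :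
    OscBound a b (2 * K * B) (fun s => (f s : ℂ) * g s) := by
  rw [two_mul]
  refine h.mul_ofReal hf hf' (fun s hs => abs_le.2 ⟨?_, (hK s hs).2⟩) fun c hc d hd hcd => ?_
  · linarith [hK s hs]
  · have hsub := uIcc_subset_Ioo_of_mem hc hd
    rw [intervalIntegral.integral_congr fun s hs => abs_of_nonpos (h0 s (hsub hs)),
      intervalIntegral.integral_neg,
      intervalIntegral.integral_eq_sub_of_hasDerivAt (fun s hs => hf s (hsub hs))
        (hf'.mono hsub).intervalIntegrable]
    linarith [hK c hc, hK d hd]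

lemma comp (h : OscBound a b B g) {a' b' : ℝ} {f f' : ℝ → ℝ}
    (hm : MapsTo f (Ioo a' b') (Ioo a b))
    (hf : ∀ s ∈ Ioo a' b', HasDerivAt f (f' s) s) (hf' : ContinuousOn f' (Ioo a' b')) :
    OscBound a' b' B (fun s => (f' s : ℂ) * g (f s)) := by
  refine ⟨(Complex.continuous_ofReal.comp_continuousOn hf').mul (h.1.comp
    (fun s hs => (hf s hs).continuousAt.continuousWithinAt) hm), fun c hc d hd => ?_⟩
  have hsub := uIcc_subset_Ioo_of_mem hc hd
  have := intervalIntegral.integral_deriv_smul_comp' (a := c) (b := d) (g := g)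
    (fun s hs => hf s (hsub hs)) (hf'.mono hsub) (h.1.mono (image_subset_iff.2 (hsub.trans hm)))
  simp only [Function.comp, Complex.real_smul] at this
  rw [this]
  exact h.2 _ (hm hc) _ (hm hd)

lemma norm_setIntegral_le (h : OscBound a b B g) (hab : a < b) :
    ‖∫ s in Ioo a b, g s‖ ≤ B := by
  have hB : 0 ≤ B := (norm_nonneg _).trans
    (h.2 ((a + b) / 2) ⟨by linarith, by linarith⟩ ((a + b) / 2) ⟨by linarith, by linarith⟩)
  by_cases hi : IntegrableOn g (Ioo a b)
  swap
  · rw [integral_undef hi, norm_zero]; exact hB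
  have hδ : Filter.Tendsto (fun n : ℕ => (b - a) / 3 * (1 / ((n : ℝ) + 1))) Filter.atTop
      (nhds 0) := by
    simpa using tendsto_one_div_add_atTop_nhds_zero_nat.const_mul ((b - a) / 3)
  have hA := hδ.const_add a
  have hB' := hδ.const_sub b
  rw [add_zero] at hA
  rw [sub_zero] at hB'
  have hc := aecover_Ioo_of_Ioc (μ := volume) hA hB'
  refine le_of_tendsto (hc.integral_tendsto_of_countably_generated hi).norm
    (Filter.Eventually.of_forall fun n => ?_)
  have hn : 0 < 1 / ((n : ℝ) + 1) ∧ 1 / ((n : ℝ) + 1) ≤ 1 :=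
    ⟨by positivity, by rw [div_le_one (by positivity)]; linarith [n.cast_nonneg (α := ℝ)]⟩
  set r := (b - a) / 3 * (1 / ((n : ℝ) + 1))
  have hr0 : 0 < r := mul_pos (by linarith) hn.1
  have hr1 : r ≤ (b - a) / 3 := mul_le_of_le_one_right (by linarith) hn.2
  rw [Measure.restrict_restrict measurableSet_Ioc,
    inter_eq_left.2 (show Ioc (a + r) (b - r) ⊆ Ioo a b from
      fun s hs => ⟨by linarith [hs.1], by linarith [hs.2]⟩),
    ← intervalIntegral.integral_of_le (by linarith)]
  exact h.2 _ ⟨by linarith, by linarith⟩ _ ⟨by linarith, by linarith⟩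

end OscBound

variable {a b : ℝ} {φ φ' φ'' : ℝ → ℝ}

/-- The first derivative test for oscillatory integrals. -/
lemma oscBound_of_le_deriv {ν : ℝ} (hν : 0 < ν) (h1 : ∀ s ∈ Ioo a b, HasDerivAt φ (φ' s) s)
    (h2 : ∀ s ∈ Ioo a b, HasDerivAt φ' (φ'' s) s) (hc : ContinuousOn φ'' (Ioo a b))
    (h0 : ∀ s ∈ Ioo a b, 0 ≤ φ'' s) (hφ : ∀ s ∈ Ioo a b, ν ≤ φ' s) :
    OscBound a b (4 / ν) (fun s => Complex.exp (I * (φ s : ℂ))) := by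
  have c1 : ContinuousOn φ (Ioo a b) := fun s hs => (h1 s hs).continuousAt.continuousWithinAt
  have c2 : ContinuousOn φ' (Ioo a b) := fun s hs => (h2 s hs).continuousAt.continuousWithinAt
  have hpos : ∀ s ∈ Ioo a b, 0 < φ' s := fun s hs => hν.trans_le (hφ s hs)
  have hcont : ContinuousOn (fun s => I * (φ' s : ℂ) * Complex.exp (I * (φ s : ℂ))) (Ioo a b) := by
    fun_prop
  have hg : OscBound a b 2 (fun s => I * (φ' s : ℂ) * Complex.exp (I * (φ s : ℂ))) := by
    refine ⟨hcont, fun c hc d hd => ?_⟩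
    have hsub := uIcc_subset_Ioo_of_mem hc hd
    rw [intervalIntegral.integral_eq_sub_of_hasDerivAt (f := fun s => Complex.exp (I * (φ s : ℂ)))
      (fun s hs => ?_) (hcont.mono hsub).intervalIntegrable]
    · refine (norm_sub_le _ _).trans ?_
      rw [norm_exp_I_mul_ofReal, norm_exp_I_mul_ofReal]; norm_num
    · have := ((h1 s (hsub hs)).ofReal_comp.const_mul I).cexp
      rwa [mul_comm] at this
  have := (hg.const_mul (-I)).mul_antitone (f := fun s => (φ' s)⁻¹)
    (f' := fun s => -φ'' s / φ' s ^ 2) (K := 1 / ν)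
    (fun s hs => (h2 s hs).inv (hpos s hs).ne')
    (hc.neg.div (c2.pow 2) fun s hs => (pow_pos (hpos s hs) 2).ne')
    (fun s hs => div_nonpos_of_nonpos_of_nonneg (neg_nonpos.2 (h0 s hs)) (sq_nonneg _))
    (fun s hs => ⟨(inv_pos.2 (hpos s hs)).le, by
      rw [one_div]; exact inv_anti₀ hν (hφ s hs)⟩)
  refine (this.mono (le_of_eq ?_)).congr fun s hs => ?_
  · simp; ring
  · have : (φ' s : ℂ) ≠ 0 := by exact_mod_cast (hpos s hs).ne'
    rw [Complex.ofReal_inv]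
    field_simp
    simp

lemma norm_integral_le_of_deriv_nonneg {μ : ℝ} (hμ : 0 < μ)
    (h1 : ∀ s ∈ Ioo a b, HasDerivAt φ (φ' s) s)
    (h2 : ∀ s ∈ Ioo a b, HasDerivAt φ' (φ'' s) s) (hc : ContinuousOn φ'' (Ioo a b))
    (h0 : ∀ s ∈ Ioo a b, μ ≤ φ'' s) {m d : ℝ} (hm : m ∈ Ioo a b) (hd : d ∈ Ioo a b) (hmd : m ≤ d)
    (hm0 : 0 ≤ φ' m) :
    ‖∫ s in m..d, Complex.exp (I * (φ s : ℂ))‖ ≤ 9 / √μ := by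
  have hr : 0 < √μ := Real.sqrt_pos.2 hμ
  have hr2 : √μ * √μ = μ := Real.mul_self_sqrt hμ.le
  set δ := 1 / √μ with hδ
  have hδ0 : 0 < δ := by positivity
  have triv : ∀ u v : ℝ, ‖∫ s in u..v, Complex.exp (I * (φ s : ℂ))‖ ≤ |v - u| := fun u v => by
    simpa using intervalIntegral.norm_integral_le_of_norm_le_const
      (f := fun s => Complex.exp (I * (φ s : ℂ))) (a := u) (b := v) (C := 1)
      (fun s _ => (norm_exp_I_mul_ofReal _).le)
  have h9 : 9 / √μ = 9 * δ := by rw [hδ]; ring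
  rw [h9]
  by_cases hdm : d ≤ m + δ
  · refine (triv m d).trans ?_
    rw [abs_of_nonneg (by linarith)]; linarith
  push Not at hdm
  have hmono : ∀ s ∈ Ioo (m + δ / 2) b, √μ / 2 ≤ φ' s := fun s hs => by
    have hs' : s ∈ Ioo a b := ⟨by linarith [hm.1, hs.1], hs.2⟩
    have := (convex_Ioo a b).mul_sub_le_image_sub_of_le_deriv (f := φ') (C := μ)
      (fun s hs => (h2 s hs).continuousAt.continuousWithinAt)
      (fun s hs => by
        rw [interior_Ioo] at hs ⊢
        exact (h2 s hs).differentiableAt.differentiableWithinAt)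
      (fun s hs => by
        rw [interior_Ioo] at hs
        rw [(h2 s hs).deriv]; exact h0 s hs) m hm s hs' (by linarith [hs.1])
    have h3 : μ * (δ / 2) ≤ μ * (s - m) := mul_le_mul_of_nonneg_left (by linarith [hs.1]) hμ.le
    have h4 : μ * (δ / 2) = √μ / 2 := by
      rw [hδ]; nth_rw 1 [← hr2]; field_simp
    linarith
  have hsub : Ioo (m + δ / 2) b ⊆ Ioo a b := Ioo_subset_Ioo_left (by linarith [hm.1])
  have hosc := oscBound_of_le_deriv (half_pos hr) (fun s hs => h1 s (hsub hs))
    (fun s hs => h2 s (hsub hs)) (hc.mono hsub) (fun s hs => hμ.le.trans (h0 s (hsub hs))) hmono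
  have hmδ : m + δ ∈ Ioo (m + δ / 2) b := ⟨by linarith, by linarith [hd.2]⟩
  have hd' : d ∈ Ioo (m + δ / 2) b := ⟨by linarith, hd.2⟩
  have hcont : ContinuousOn (fun s => Complex.exp (I * (φ s : ℂ))) (Ioo a b) := by
    have c1 : ContinuousOn φ (Ioo a b) := fun s hs => (h1 s hs).continuousAt.continuousWithinAt
    fun_prop
  rw [← intervalIntegral.integral_add_adjacent_intervals (b := m + δ)
    (hcont.mono (uIcc_subset_Ioo_of_mem hm (hsub hmδ))).intervalIntegrable
    (hosc.intervalIntegrable hmδ hd')]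
  have e1 := triv m (m + δ)
  rw [add_sub_cancel_left, abs_of_pos hδ0] at e1
  have e2 := hosc.2 _ hmδ _ hd'
  have e3 : 4 / (√μ / 2) = 8 * δ := by rw [hδ]; field_simp; norm_num
  linarith [norm_add_le (∫ s in m..(m + δ), Complex.exp (I * (φ s : ℂ)))
    (∫ s in (m + δ)..d, Complex.exp (I * (φ s : ℂ)))]

/-- The second derivative test of van der Corput. -/
lemma oscBound_of_le_deriv2 {μ : ℝ} (hμ : 0 < μ)
    (h1 : ∀ s ∈ Ioo a b, HasDerivAt φ (φ' s) s)
    (h2 : ∀ s ∈ Ioo a b, HasDerivAt φ' (φ'' s) s) (hc : ContinuousOn φ'' (Ioo a b))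
    (h0 : ∀ s ∈ Ioo a b, μ ≤ φ'' s) :
    OscBound a b (18 / √μ) (fun s => Complex.exp (I * (φ s : ℂ))) := by
  have hpos : 0 < 9 / √μ := by have := Real.sqrt_pos.2 hμ; positivity
  have h18 : 18 / √μ = 9 / √μ + 9 / √μ := by ring
  have c2 : ContinuousOn φ' (Ioo a b) := fun s hs => (h2 s hs).continuousAt.continuousWithinAt
  have hcont : ContinuousOn (fun s => Complex.exp (I * (φ s : ℂ))) (Ioo a b) := by
    have c1 : ContinuousOn φ (Ioo a b) := fun s hs => (h1 s hs).continuousAt.continuousWithinAt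
    fun_prop
  have right : ∀ m ∈ Ioo a b, ∀ d ∈ Ioo a b, m ≤ d → 0 ≤ φ' m →
      ‖∫ s in m..d, Complex.exp (I * (φ s : ℂ))‖ ≤ 9 / √μ := fun m hm d hd hmd hm0 =>
    norm_integral_le_of_deriv_nonneg hμ h1 h2 hc h0 hm hd hmd hm0
  have left : ∀ c ∈ Ioo a b, ∀ m ∈ Ioo a b, c ≤ m → φ' m ≤ 0 →
      ‖∫ s in c..m, Complex.exp (I * (φ s : ℂ))‖ ≤ 9 / √μ := fun c hc' m hm hcm hm0 => by
    have hneg : ∀ s ∈ Ioo (-b) (-a), -s ∈ Ioo a b := fun s hs =>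
      ⟨by linarith [hs.2], by linarith [hs.1]⟩
    have := norm_integral_le_of_deriv_nonneg (a := -b) (b := -a) (φ := fun s => φ (-s))
      (φ' := fun s => -φ' (-s)) (φ'' := fun s => φ'' (-s)) hμ
      (fun s hs => by
        simpa [Function.comp_def] using (h1 (-s) (hneg s hs)).comp s (hasDerivAt_neg s))
      (fun s hs => by
        simpa [Function.comp_def, Pi.neg_def] using
          ((h2 (-s) (hneg s hs)).comp s (hasDerivAt_neg s)).neg)
      (hc.comp continuousOn_neg hneg) (fun s hs => h0 _ (hneg s hs)) (m := -m) (d := -c)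
      ⟨by linarith [hm.2], by linarith [hm.1]⟩ ⟨by linarith [hc'.2], by linarith [hc'.1]⟩
      (by linarith) (by simpa using hm0)
    rw [intervalIntegral.integral_comp_neg (fun s => Complex.exp (I * (φ s : ℂ)))] at this
    simpa using this
  refine OscBound.of_le hcont fun c hc' d hd hcd => ?_
  rw [h18]
  by_cases hφc : 0 ≤ φ' c
  · linarith [right c hc' d hd hcd hφc]
  by_cases hφd : φ' d ≤ 0
  · linarith [left c hc' d hd hcd hφd]
  push Not at hφc hφd
  obtain ⟨m, hm, hm0⟩ := intermediate_value_Icc hcd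
    (c2.mono (Icc_subset_uIcc.trans (uIcc_subset_Ioo_of_mem hc' hd))) ⟨hφc.le, hφd.le⟩
  have hm' : m ∈ Ioo a b := ⟨hc'.1.trans_le hm.1, hm.2.trans_lt hd.2⟩
  rw [← intervalIntegral.integral_add_adjacent_intervals (b := m)
    (hcont.mono (uIcc_subset_Ioo_of_mem hc' hm')).intervalIntegrable
    (hcont.mono (uIcc_subset_Ioo_of_mem hm' hd)).intervalIntegrable]
  exact (norm_add_le _ _).trans
    (add_le_add (left c hc' m hm' hm.1 hm0.le) (right m hm' d hd hm.2 hm0.ge))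

lemma oscBound_of_deriv2_le {μ : ℝ} (hμ : 0 < μ)
    (h1 : ∀ s ∈ Ioo a b, HasDerivAt φ (φ' s) s)
    (h2 : ∀ s ∈ Ioo a b, HasDerivAt φ' (φ'' s) s) (hc : ContinuousOn φ'' (Ioo a b))
    (h0 : ∀ s ∈ Ioo a b, φ'' s ≤ -μ) :
    OscBound a b (18 / √μ) (fun s => Complex.exp (I * (φ s : ℂ))) := by
  refine (oscBound_of_le_deriv2 hμ (fun s hs => (h1 s hs).neg) (fun s hs => (h2 s hs).neg) hc.neg
    fun s hs => le_neg.1 (h0 s hs)).conj.congr fun s _ => ?_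
  rw [← Complex.exp_conj]
  simp

end Oscillatory

section RhoPlus

open Set

lemma rhoPlus_of_one_lt {l : ℝ} (hl : 1 < l) : rhoPlus l = (√(l ^ 2 - 1) : ℂ) := by
  rw [rhoPlus, if_pos hl]

lemma rhoPlus_of_mem_Ioo {l : ℝ} (hl : l ∈ Ioo (0 : ℝ) 1) : rhoPlus l = I * (√(1 - l ^ 2) : ℂ) := by
  rw [rhoPlus, if_neg (by linarith [hl.2]), if_neg (by linarith [hl.1])]

lemma sub_rhoPlus_mul_add_rhoPlus {l : ℝ} (hl : 0 < l) :
    ((l : ℂ) - rhoPlus l) * ((l : ℂ) + rhoPlus l) = 1 := by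
  unfold rhoPlus
  split_ifs with h1 h2
  · have : ((√(l ^ 2 - 1) : ℝ) : ℂ) ^ 2 = (l : ℂ) ^ 2 - 1 := by
      exact_mod_cast Real.sq_sqrt (by nlinarith)
    linear_combination -this
  · linarith
  · have : ((√(1 - l ^ 2) : ℝ) : ℂ) ^ 2 = 1 - (l : ℂ) ^ 2 := by
      exact_mod_cast Real.sq_sqrt (by nlinarith)
    linear_combination this - ((√(1 - l ^ 2) : ℝ) : ℂ) ^ 2 * I_sq

lemma rhoPlus_neg (l : ℝ) : rhoPlus (-l) = -(starRingEnd ℂ) (rhoPlus l) := by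
  unfold rhoPlus
  split_ifs <;> first | linarith | simp

lemma Kaux_neg (l x y : ℝ) : Kaux (-l) x y = (starRingEnd ℂ) (Kaux l x y) := by
  have e : ∀ z : ℂ, (starRingEnd ℂ) (Complex.exp z) = Complex.exp ((starRingEnd ℂ) z) :=
    fun z => (Complex.exp_conj z).symm
  have hr := rhoPlus_neg l
  unfold Kaux
  rw [hr]
  have hR : (((-l : ℝ) : ℂ) - -(starRingEnd ℂ) (rhoPlus l)) /
      (((-l : ℝ) : ℂ) + -(starRingEnd ℂ) (rhoPlus l)) =
      ((l : ℂ) - (starRingEnd ℂ) (rhoPlus l)) / ((l : ℂ) + (starRingEnd ℂ) (rhoPlus l)) := by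
    rw [← neg_div_neg_eq]; push_cast; congr 1 <;> ring
  rw [hR]
  split_ifs <;>
  · simp only [map_add, map_mul, map_sub, map_div₀, map_one, map_neg, e, conj_I, conj_ofReal,
      map_ofNat]
    push_cast
    ring_nf

end RhoPlus

section Derivatives

open Set

lemma hasDerivAt_sqrt_sq_sub_one {s : ℝ} (hs : 1 < s) :
    HasDerivAt (fun r : ℝ => √(r ^ 2 - 1)) (s / √(s ^ 2 - 1)) s := by
  have := ((hasDerivAt_pow 2 s).sub_const 1).sqrt (by nlinarith : s ^ 2 - 1 ≠ 0)
  refine this.congr_deriv ?_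
  push_cast
  rw [pow_one, mul_div_mul_left _ _ two_ne_zero]

lemma hasDerivAt_sqrt_one_sub_sq {s : ℝ} (hs : s ∈ Ioo (0 : ℝ) 1) :
    HasDerivAt (fun r : ℝ => √(1 - r ^ 2)) (-(s / √(1 - s ^ 2))) s := by
  have := ((hasDerivAt_pow 2 s).const_sub 1).sqrt (by nlinarith [hs.1, hs.2] : 1 - s ^ 2 ≠ 0)
  refine this.congr_deriv ?_
  push_cast
  rw [pow_one, neg_div, mul_div_mul_left _ _ two_ne_zero]

lemma hasDerivAt_sqrt_sq_add_one (s : ℝ) :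
    HasDerivAt (fun r : ℝ => √(r ^ 2 + 1)) (s / √(s ^ 2 + 1)) s := by
  have := ((hasDerivAt_pow 2 s).add_const 1).sqrt (by positivity : s ^ 2 + 1 ≠ 0)
  refine this.congr_deriv ?_
  push_cast
  rw [pow_one, mul_div_mul_left _ _ two_ne_zero]

lemma sqrt_sq_sub_one_pos {s : ℝ} (hs : 1 < s) : 0 < √(s ^ 2 - 1) :=
  Real.sqrt_pos.2 (by nlinarith)

lemma sqrt_one_sub_sq_pos {s : ℝ} (hs : s ∈ Ioo (0 : ℝ) 1) : 0 < √(1 - s ^ 2) :=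
  Real.sqrt_pos.2 (by nlinarith [hs.1, hs.2])

lemma sqrt_sq_sub_one_lt {s : ℝ} (hs : 1 < s) : √(s ^ 2 - 1) < s := by
  rw [Real.sqrt_lt' (by linarith)]; linarith

lemma sqrt_one_sub_sq_lt_one {s : ℝ} (hs : s ∈ Ioo (0 : ℝ) 1) : √(1 - s ^ 2) < 1 := by
  rw [Real.sqrt_lt' one_pos]; nlinarith [hs.1]

lemma continuousOn_div_sqrt_sq_sub_one (b : ℝ) :
    ContinuousOn (fun s : ℝ => s / √(s ^ 2 - 1)) (Ioo 1 b) :=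
  continuousOn_id.div (by fun_prop) fun _ hs => (sqrt_sq_sub_one_pos hs.1).ne'

lemma continuousOn_div_sqrt_one_sub_sq :
    ContinuousOn (fun s : ℝ => s / √(1 - s ^ 2)) (Ioo 0 1) :=
  continuousOn_id.div (by fun_prop) fun _ hs => (sqrt_one_sub_sq_pos hs).ne'

end Derivatives

section Phases

open Set

lemma oscBound_quadratic {t : ℝ} (ht : t ≠ 0) (a b p : ℝ) :
    OscBound a b (18 / √|t|)
      (fun s => Complex.exp (I * t * (s : ℂ) ^ 2) * Complex.exp (I * s * p)) := by
  have h1 : ∀ s : ℝ, HasDerivAt (fun s => t * s ^ 2 + p * s) (2 * t * s + p) s := fun s => by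
    have := ((hasDerivAt_pow 2 s).const_mul t).add ((hasDerivAt_id s).const_mul p)
    refine this.congr_deriv ?_
    push_cast; ring
  have h2 : ∀ s : ℝ, HasDerivAt (fun s => 2 * t * s + p) (2 * t) s := fun s => by
    simpa using ((hasDerivAt_id s).const_mul (2 * t)).add_const p
  have key : OscBound a b (18 / √|t|)
      (fun s => Complex.exp (I * ((t * s ^ 2 + p * s : ℝ) : ℂ))) := by
    rcases ht.lt_or_gt with h | h
    · exact oscBound_of_deriv2_le (abs_pos.2 ht) (fun s _ => h1 s) (fun s _ => h2 s)
        continuousOn_const fun s _ => by rw [abs_of_neg h]; linarith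
    · exact oscBound_of_le_deriv2 (abs_pos.2 ht) (fun s _ => h1 s) (fun s _ => h2 s)
        continuousOn_const fun s _ => by rw [abs_of_pos h]; linarith
  refine key.congr fun s _ => ?_
  rw [← Complex.exp_add]
  congr 1
  push_cast; ring

lemma oscBound_quadratic_add_sqrt {t z : ℝ} (ht : 0 < t) (hz : 0 ≤ z) (a b x : ℝ) :
    OscBound a b (18 / √|t|)
      (fun s => Complex.exp (I * ((t * s ^ 2 + x * s + z * √(s ^ 2 + 1) : ℝ) : ℂ))) := by
  have hp : ∀ s : ℝ, 0 < √(s ^ 2 + 1) := fun s => Real.sqrt_pos.2 (by positivity)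
  have hsq : ∀ s : ℝ, √(s ^ 2 + 1) ^ 2 = s ^ 2 + 1 := fun s => Real.sq_sqrt (by positivity)
  refine oscBound_of_le_deriv2 (φ' := fun s => 2 * t * s + x + z * (s / √(s ^ 2 + 1)))
    (φ'' := fun s => 2 * t + z * (1 / √(s ^ 2 + 1) ^ 3)) (abs_pos.2 ht.ne') (fun s _ => ?_)
    (fun s _ => ?_) ?_ (fun s _ => ?_)
  · have := (((hasDerivAt_pow 2 s).const_mul t).add ((hasDerivAt_id s).const_mul x)).add
      ((hasDerivAt_sqrt_sq_add_one s).const_mul z)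
    refine this.congr_deriv ?_
    push_cast; ring
  · have := (((hasDerivAt_id s).const_mul (2 * t)).add_const x).add
      (((hasDerivAt_id s).div (hasDerivAt_sqrt_sq_add_one s) (hp s).ne').const_mul z)
    refine this.congr_deriv ?_
    have h := (hp s).ne'
    simp only [id]
    rw [mul_one]
    congr 2
    field_simp
    rw [hsq]; ring
  · refine Continuous.continuousOn ?_
    have : Continuous fun s : ℝ => 1 / √(s ^ 2 + 1) ^ 3 :=
      continuous_const.div (by fun_prop) fun s => (pow_pos (hp s) 3).ne'
    fun_prop
  · have : 0 ≤ z * (1 / √(s ^ 2 + 1) ^ 3) := by have := hp s; positivity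
    rw [abs_of_pos ht]; linarith

lemma OscBound.comp_sqrt_sq_sub_one {b B : ℝ} {g : ℝ → ℂ} (h : OscBound 0 b B g) :
    OscBound 1 b B (fun s => ((s / √(s ^ 2 - 1) : ℝ) : ℂ) * g (√(s ^ 2 - 1))) :=
  h.comp (fun _ hs => ⟨sqrt_sq_sub_one_pos hs.1, (sqrt_sq_sub_one_lt hs.1).trans hs.2⟩)
    (fun _ hs => hasDerivAt_sqrt_sq_sub_one hs.1) (continuousOn_div_sqrt_sq_sub_one b)

lemma OscBound.comp_sqrt_one_sub_sq {B : ℝ} {g : ℝ → ℂ} (h : OscBound 0 1 B g) :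
    OscBound 0 1 B (fun s => ((-(s / √(1 - s ^ 2)) : ℝ) : ℂ) * g (√(1 - s ^ 2))) :=
  h.comp (fun _ hs => ⟨sqrt_one_sub_sq_pos hs, sqrt_one_sub_sq_lt_one hs⟩)
    (fun _ hs => hasDerivAt_sqrt_one_sub_sq hs) continuousOn_div_sqrt_one_sub_sq.neg

lemma oscBound_sqrt_sq_sub_one {t x z : ℝ} (ht : t ≠ 0) (hx : 0 ≤ x) (hz : 0 ≤ z) (b : ℝ) :
    OscBound 1 b (2 * (18 / √|t|))
      (fun s => Complex.exp (I * ((t * s ^ 2 + x * √(s ^ 2 - 1) + z * s : ℝ) : ℂ))) := by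
  have hsq : ∀ s ∈ Ioo 1 b, √(s ^ 2 - 1) ^ 2 = s ^ 2 - 1 := fun s hs =>
    Real.sq_sqrt (by nlinarith [hs.1])
  have hp : ∀ s ∈ Ioo 1 b, 0 < √(s ^ 2 - 1) := fun s hs => sqrt_sq_sub_one_pos hs.1
  rcases ht.lt_or_gt with h | h
  · have h0 : (0 : ℝ) ≤ 18 / √|t| := by positivity
    refine (oscBound_of_deriv2_le (φ' := fun s => 2 * t * s + x * (s / √(s ^ 2 - 1)) + z)
      (φ'' := fun s => 2 * t - x * (1 / √(s ^ 2 - 1) ^ 3)) (abs_pos.2 ht) (fun s hs => ?_)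
      (fun s hs => ?_) ?_ (fun s hs => ?_)).mono (by linarith)
    · have := (((hasDerivAt_pow 2 s).const_mul t).add
        ((hasDerivAt_sqrt_sq_sub_one hs.1).const_mul x)).add ((hasDerivAt_id s).const_mul z)
      refine this.congr_deriv ?_
      push_cast; ring
    · have := (((hasDerivAt_id s).const_mul (2 * t)).add (((hasDerivAt_id s).div
        (hasDerivAt_sqrt_sq_sub_one hs.1) (hp s hs).ne').const_mul x)).add_const z
      refine this.congr_deriv ?_
      have h := (hp s hs).ne'
      simp only [id]
      rw [mul_one, sub_eq_add_neg, ← mul_neg]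
      congr 2
      field_simp
      rw [hsq s hs]; ring
    · have : ContinuousOn (fun s : ℝ => 1 / √(s ^ 2 - 1) ^ 3) (Ioo 1 b) :=
        continuousOn_const.div (by fun_prop) fun s hs => (pow_pos (hp s hs) 3).ne'
      fun_prop
    · have : 0 ≤ x * (1 / √(s ^ 2 - 1) ^ 3) := by have := hp s hs; positivity
      rw [abs_of_neg h]; linarith
  · have key := ((oscBound_quadratic_add_sqrt h hz 0 b x).comp_sqrt_sq_sub_one.mul_monotone
      (f := fun s => √(s ^ 2 - 1) / s) (f' := fun s => 1 / (s ^ 2 * √(s ^ 2 - 1))) (K := 1)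
      (fun s hs => ?_) ?_ (fun s hs => by have := hp s hs; positivity)
      fun s hs => ?_).const_mul (Complex.exp (I * t))
    · refine (key.mono (le_of_eq ?_)).congr fun s hs => ?_
      · rw [Complex.norm_exp_I_mul_ofReal]; ring
      · have h1 : (s : ℂ) ≠ 0 := by exact_mod_cast (by linarith [hs.1] : s ≠ 0)
        have h2 : ((√(s ^ 2 - 1) : ℝ) : ℂ) ≠ 0 := by exact_mod_cast (hp s hs).ne'
        have h3 : √(√(s ^ 2 - 1) ^ 2 + 1) = s := by
          rw [hsq s hs, sub_add_cancel, Real.sqrt_sq (by linarith [hs.1])]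
        rw [h3, hsq s hs, Complex.ofReal_div, Complex.ofReal_div, ← mul_assoc (_ / _),
          div_mul_div_cancel₀' h2, div_self h1, one_mul, ← Complex.exp_add]
        congr 1
        push_cast; ring
    · have h1 : s ≠ 0 := by linarith [hs.1]
      have h2 := (hp s hs).ne'
      refine ((hasDerivAt_sqrt_sq_sub_one hs.1).div (hasDerivAt_id s) h1).congr_deriv ?_
      simp only [id]
      field_simp
      rw [hsq s hs]; ring
    · refine continuousOn_const.div (by fun_prop) fun s hs => ?_
      have := hp s hs
      have : 0 < s := by linarith [hs.1]
      positivity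
    · have h1 : 0 < s := by linarith [hs.1]
      exact ⟨by positivity, (div_le_one h1).2 (sqrt_sq_sub_one_lt hs.1).le⟩

end Phases

section Multipliers

open Set

namespace OscBound

variable {B : ℝ} {g : ℝ → ℂ}

lemma mul_id (h : OscBound 0 1 B g) : OscBound 0 1 (2 * B) (fun s => (s : ℂ) * g s) :=
  (h.mul_monotone (f := fun s => s) (f' := fun _ => 1) (K := 1) (fun s _ => hasDerivAt_id s)
    continuousOn_const (fun _ _ => zero_le_one) fun _ hs => ⟨hs.1.le, hs.2.le⟩).mono (by simp)

lemma mul_sub_rhoPlus_of_lt_one (h : OscBound 0 1 B g) :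
    OscBound 0 1 (4 * B) (fun s => ((s : ℂ) - rhoPlus s) * g s) := by
  have h1 := h.mul_antitone (f := fun s => √(1 - s ^ 2)) (K := 1)
    (fun s hs => hasDerivAt_sqrt_one_sub_sq hs) continuousOn_div_sqrt_one_sub_sq.neg
    (fun s hs => neg_nonpos.2 (div_nonneg hs.1.le (Real.sqrt_nonneg _)))
    fun s hs => ⟨Real.sqrt_nonneg _, (sqrt_one_sub_sq_lt_one hs).le⟩
  refine ((h.mul_id.add (h1.const_mul (-I))).mono (le_of_eq ?_)).congr fun s hs => ?_
  · simp; ring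
  · rw [rhoPlus_of_mem_Ioo hs]; ring

lemma mul_exp_rhoPlus_of_lt_one (h : OscBound 0 1 B g) {q : ℝ} (hq : 0 ≤ q) :
    OscBound 0 1 (2 * B) (fun s => Complex.exp (I * rhoPlus s * q) * g s) := by
  have h1 := h.mul_monotone (f := fun s => Real.exp (-q * √(1 - s ^ 2)))
    (f' := fun s => Real.exp (-q * √(1 - s ^ 2)) * (-q * -(s / √(1 - s ^ 2)))) (K := 1)
    (fun s hs => ((hasDerivAt_sqrt_one_sub_sq hs).const_mul (-q)).exp)
    (ContinuousOn.mul (by fun_prop) (continuousOn_const.mul continuousOn_div_sqrt_one_sub_sq.neg))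
    (fun s hs => by
      have := sqrt_one_sub_sq_pos hs
      have := hs.1
      rw [neg_mul_neg]
      positivity)
    fun s hs => ⟨(Real.exp_pos _).le, Real.exp_le_one_iff.2
      (by rw [neg_mul]; exact neg_nonpos.2 (mul_nonneg hq (Real.sqrt_nonneg _)))⟩
  refine (h1.mono (by simp)).congr fun s hs => ?_
  rw [rhoPlus_of_mem_Ioo hs, ← mul_assoc I I, I_mul_I]
  congr 1
  push_cast
  ring_nf

lemma mul_sub_rhoPlus_of_one_lt {b : ℝ} (h : OscBound 1 b B g) :
    OscBound 1 b (2 * B) (fun s => ((s : ℂ) - rhoPlus s) * g s) := by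
  have h1 := h.mul_antitone (f := fun s => s - √(s ^ 2 - 1)) (K := 1)
    (fun s hs => (hasDerivAt_id s).sub (hasDerivAt_sqrt_sq_sub_one hs.1))
    (continuousOn_const.sub (continuousOn_div_sqrt_sq_sub_one b))
    (fun s hs => by
      have := (one_le_div (sqrt_sq_sub_one_pos hs.1)).2 (sqrt_sq_sub_one_lt hs.1).le
      linarith)
    fun s hs => ⟨by linarith [sqrt_sq_sub_one_lt hs.1], by
      have : s - 1 ≤ √(s ^ 2 - 1) := Real.le_sqrt_of_sq_le (by nlinarith [hs.1])
      linarith⟩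
  refine (h1.mono (by simp)).congr fun s hs => ?_
  rw [rhoPlus_of_one_lt hs.1]
  push_cast; ring

lemma mul_id_mul_sub_rhoPlus_of_one_lt {b : ℝ} (h : OscBound 1 b B g) :
    OscBound 1 b (2 * B) (fun s => (s : ℂ) * ((s : ℂ) - rhoPlus s) * g s) := by
  have h1 := h.mul_antitone (f := fun s => s * (s - √(s ^ 2 - 1))) (K := 1)
    (fun s hs => (hasDerivAt_id s).mul
      ((hasDerivAt_id s).sub (hasDerivAt_sqrt_sq_sub_one hs.1)))
    (ContinuousOn.add (by fun_prop) (continuousOn_id.mul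
      (continuousOn_const.sub (continuousOn_div_sqrt_sq_sub_one b))))
    (fun s hs => by
      have h1 := sqrt_sq_sub_one_pos hs.1
      have h2 : √(s ^ 2 - 1) ^ 2 = s ^ 2 - 1 := Real.sq_sqrt (by nlinarith [hs.1])
      have h3 : 1 * (s - √(s ^ 2 - 1)) + s * (1 - s / √(s ^ 2 - 1)) =
          -((s - √(s ^ 2 - 1)) ^ 2 / √(s ^ 2 - 1)) := by
        field_simp; ring
      simp only [id]
      rw [h3]
      exact neg_nonpos.2 (by positivity))
    fun s hs => by
      have h1 := sqrt_sq_sub_one_lt hs.1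
      have h2 : √(s ^ 2 - 1) ^ 2 = s ^ 2 - 1 := Real.sq_sqrt (by nlinarith [hs.1])
      have h3 := sqrt_sq_sub_one_pos hs.1
      exact ⟨mul_nonneg (by linarith) (by linarith), by nlinarith⟩
  refine (h1.mono (by simp)).congr fun s hs => ?_
  rw [rhoPlus_of_one_lt hs.1]
  push_cast; ring

lemma mul_cutoff {a b M K : ℝ} (h : OscBound a b B g) {χ : ℝ → ℝ} (hχ : ContDiff ℝ 1 χ)
    (hK : ∀ l, |χ l| ≤ K) (hd : ∀ l, |deriv χ l| ≤ 1) (hM : 0 < M) (hab : b - a ≤ 8 * M) :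
    OscBound a b ((K + 8) * B) (fun s => (χ (s / M) : ℂ) * g s) := by
  have hcont : Continuous fun s => deriv χ (s / M) * (1 / M) :=
    ((hχ.continuous_deriv le_rfl).comp (continuous_id.div_const M)).mul_const _
  refine h.mul_ofReal (f := fun s => χ (s / M)) (f' := fun s => deriv χ (s / M) * (1 / M))
    (fun s _ => ?_) hcont.continuousOn (fun s _ => hK _) fun c hc d hd' hcd => ?_
  · exact ((hχ.differentiable one_ne_zero (s / M)).hasDerivAt).comp s
      ((hasDerivAt_id s).div_const M)
  · calc ∫ s in c..d, |deriv χ (s / M) * (1 / M)| ≤ ∫ _ in c..d, 1 / M := by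
          refine intervalIntegral.integral_mono hcd (hcont.abs.intervalIntegrable _ _)
            (by simp) fun s => ?_
          simp only [abs_mul]
          rw [abs_of_pos (by positivity : 0 < 1 / M)]
          exact mul_le_of_le_one_left (by positivity) (hd _)
      _ = (d - c) / M := by simp [div_eq_mul_inv]
      _ ≤ 8 := by rw [div_le_iff₀ hM]; linarith [hc.1, hd'.2]

end OscBound

end Multipliers

section Kernel

open Set

lemma oscBound_rhoPlus_of_one_lt {t q : ℝ} (ht : t ≠ 0) (b : ℝ) :
    OscBound 1 b (18 / √|t|) (fun s => s / rhoPlus s *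
      (Complex.exp (I * t * (s : ℂ) ^ 2) * Complex.exp (I * rhoPlus s * q))) := by
  refine (((oscBound_quadratic ht 0 b q).comp_sqrt_sq_sub_one.const_mul
    (Complex.exp (I * t))).mono (by simp [Complex.norm_exp_I_mul_ofReal])).congr fun s hs => ?_
  have h2 : ((√(s ^ 2 - 1) : ℝ) : ℂ) ^ 2 = (s : ℂ) ^ 2 - 1 := by
    exact_mod_cast Real.sq_sqrt (by nlinarith [hs.1])
  rw [rhoPlus_of_one_lt hs.1, h2, show I * t * (s : ℂ) ^ 2 = I * t + I * t * ((s : ℂ) ^ 2 - 1) by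
    ring, Complex.exp_add]
  push_cast
  ring

lemma oscBound_rhoPlus_of_lt_one {t q : ℝ} (ht : t ≠ 0) (hq : 0 ≤ q) :
    OscBound 0 1 (2 * (18 / √|t|)) (fun s => s / rhoPlus s *
      (Complex.exp (I * t * (s : ℂ) ^ 2) * Complex.exp (I * rhoPlus s * q))) := by
  refine ((((oscBound_quadratic (neg_ne_zero.2 ht) 0 1 0).comp_sqrt_one_sub_sq.const_mul
    (I * Complex.exp (I * t))).mul_exp_rhoPlus_of_lt_one hq).mono
      (by simp [Complex.norm_exp_I_mul_ofReal])).congr fun s hs => ?_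
  have h2 : ((√(1 - s ^ 2) : ℝ) : ℂ) ^ 2 = 1 - (s : ℂ) ^ 2 := by
    exact_mod_cast Real.sq_sqrt (by nlinarith [hs.1, hs.2])
  rw [h2, show I * t * (s : ℂ) ^ 2 = I * t + I * ((-t : ℝ) : ℂ) * (1 - (s : ℂ) ^ 2) by
    push_cast; ring, Complex.exp_add]
  have h3 : (s : ℂ) / rhoPlus s = -I * ((s / √(1 - s ^ 2) : ℝ) : ℂ) := by
    rw [rhoPlus_of_mem_Ioo hs, div_mul_eq_div_div, div_I]
    push_cast; ring
  rw [h3]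
  simp
  ring

lemma oscBound_mul_Kaux {a b t x y : ℝ} (ha : 0 ≤ a) (ht : t ≠ 0) (hyx : y ≤ x)
    (hR : ∀ (B : ℝ) (g : ℝ → ℂ), OscBound a b B g →
      OscBound a b (4 * B) (fun s => ((s : ℂ) - rhoPlus s) * g s))
    (hT : ∀ z w : ℝ, 0 ≤ z → 0 ≤ w → OscBound a b (16 * (18 / √|t|)) (fun s =>
      (s : ℂ) * ((s : ℂ) - rhoPlus s) * (Complex.exp (I * t * (s : ℂ) ^ 2) *
        Complex.exp (I * rhoPlus s * z) * Complex.exp (I * s * w))))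
    (hρ : ∀ q : ℝ, 0 ≤ q → OscBound a b (2 * (18 / √|t|)) (fun s => s / rhoPlus s *
      (Complex.exp (I * t * (s : ℂ) ^ 2) * Complex.exp (I * rhoPlus s * q)))) :
    OscBound a b (17 * (18 / √|t|))
      (fun s => Complex.exp (I * t * (s : ℂ) ^ 2) * s * Kaux s x y) := by
  have hB : 0 ≤ 18 / √|t| := by positivity
  have hinv : ∀ s ∈ Ioo a b, 1 / ((s : ℂ) + rhoPlus s) = (s : ℂ) - rhoPlus s := fun s hs => by
    have h := sub_rhoPlus_mul_add_rhoPlus (ha.trans_lt hs.1)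
    rw [one_div, eq_comm]
    exact eq_inv_of_mul_eq_one_left h
  have hdiv : ∀ s ∈ Ioo a b, ((s : ℂ) - rhoPlus s) / ((s : ℂ) + rhoPlus s) =
      ((s : ℂ) - rhoPlus s) * ((s : ℂ) - rhoPlus s) := fun s hs => by
    rw [← hinv s hs]; ring
  have hI : (1 / (2 * I) : ℂ) = -I / 2 := by
    rw [one_div, mul_inv, inv_I]; ring
  by_cases hx : x < 0
  · have key := ((oscBound_quadratic ht a b (x - y)).add
      (hR _ _ (hR _ _ (oscBound_quadratic ht a b (-(x + y)))))).const_mul (1 / (2 * I))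
    refine (key.mono ?_).congr fun s hs => ?_
    · simp; linarith
    · have h0 : (s : ℂ) ≠ 0 := by exact_mod_cast (ha.trans_lt hs.1).ne'
      have h1 : (1 / (2 * I * (s : ℂ))) = 1 / (2 * I) * (s : ℂ)⁻¹ := by
        rw [one_div, mul_inv, one_div]
      rw [Kaux, if_pos hx, hdiv s hs, h1]
      push_cast
      rw [show -(I * (s : ℂ) * ((x : ℂ) + y)) = I * s * (-((x : ℂ) + y)) by ring]
      field_simp
  push Not at hx
  by_cases hy : 0 < y
  · have key := ((hR _ _ (hR _ _ (hρ (x + y) (by linarith)))).add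
      (hρ (x - y) (by linarith))).const_mul (1 / (2 * I))
    refine (key.mono ?_).congr fun s hs => ?_
    · simp; linarith
    · have h1 : (1 / (2 * I * rhoPlus s)) = 1 / (2 * I) * (rhoPlus s)⁻¹ := by
        rw [one_div, mul_inv, one_div]
      rw [Kaux, if_neg (not_lt.2 hx), if_pos hy, hdiv s hs, h1]
      push_cast
      ring
  · push Not at hy
    refine (((hT x (-y) hx (by linarith)).const_mul (-I)).mono ?_).congr fun s hs => ?_
    · simp; linarith
    · have h1 : 1 / (I * (rhoPlus s + (s : ℂ))) = -I * ((s : ℂ) - rhoPlus s) := by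
        rw [← hinv s hs, one_div, mul_inv, inv_I, add_comm, one_div]
      rw [Kaux, if_neg (not_lt.2 hx), if_neg (not_lt.2 hy), h1]
      push_cast
      rw [show -(I * (s : ℂ) * (y : ℂ)) = I * s * (-(y : ℂ)) by ring]
      ring

lemma oscBound_mul_Kaux_of_lt_one {t x y : ℝ} (ht : t ≠ 0) (hyx : y ≤ x) :
    OscBound 0 1 (17 * (18 / √|t|))
      (fun s => Complex.exp (I * t * (s : ℂ) ^ 2) * s * Kaux s x y) := by
  refine oscBound_mul_Kaux le_rfl ht hyx (fun B g h => h.mul_sub_rhoPlus_of_lt_one)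
    (fun z w hz _ => ?_) (fun q hq => oscBound_rhoPlus_of_lt_one ht hq)
  refine ((((oscBound_quadratic ht 0 1 w).mul_exp_rhoPlus_of_lt_one
    hz).mul_sub_rhoPlus_of_lt_one.mul_id).mono (by linarith)).congr fun s _ => ?_
  ring

lemma oscBound_mul_Kaux_of_one_lt {t x y : ℝ} (ht : t ≠ 0) (hyx : y ≤ x) (b : ℝ) :
    OscBound 1 b (17 * (18 / √|t|))
      (fun s => Complex.exp (I * t * (s : ℂ) ^ 2) * s * Kaux s x y) := by
  have hB : 0 ≤ 18 / √|t| := by positivity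
  refine oscBound_mul_Kaux zero_le_one ht hyx (fun B g h => ?_)
    (fun z w hz hw => ?_) (fun q _ => (oscBound_rhoPlus_of_one_lt ht b).mono (by linarith))
  · by_cases hb : 1 < b
    · have hB : 0 ≤ B := (norm_nonneg _).trans (h.2 ((1 + b) / 2) ⟨by linarith, by linarith⟩
        ((1 + b) / 2) ⟨by linarith, by linarith⟩)
      exact h.mul_sub_rhoPlus_of_one_lt.mono (by linarith)
    · refine ⟨?_, ?_⟩ <;> simp [Ioo_eq_empty hb]
  · refine (((oscBound_sqrt_sq_sub_one ht hz hw b).mul_id_mul_sub_rhoPlus_of_one_lt).mono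
      (by linarith)).congr fun s hs => ?_
    rw [← Complex.exp_add, ← Complex.exp_add, rhoPlus_of_one_lt hs.1]
    congr 2
    push_cast; ring

lemma norm_setIntegral_Ioi_le {χ : ℝ → ℝ} {K M t x y : ℝ} (hχ : ContDiff ℝ 1 χ)
    (hzero : ∀ l : ℝ, 8 ≤ |l| → χ l = 0) (hK : ∀ l, |χ l| ≤ K) (hd : ∀ l, |deriv χ l| ≤ 1)
    (hM : 1 < M) (ht : t ≠ 0) (hyx : y ≤ x) :
    ‖∫ l in Ioi (0 : ℝ), Complex.exp (I * (t : ℂ) * (l : ℂ) ^ 2) * (l : ℂ)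
        * (χ (l / M) : ℂ) * Kaux l x y‖ ≤ 2 * ((K + 8) * (17 * (18 / √|t|))) := by
  set F : ℝ → ℂ := fun l => Complex.exp (I * (t : ℂ) * (l : ℂ) ^ 2) * (l : ℂ)
        * (χ (l / M) : ℂ) * Kaux l x y with hF
  have hK0 : 0 ≤ K := (abs_nonneg _).trans (hK 0)
  have h1 := (((oscBound_mul_Kaux_of_lt_one ht hyx).mul_cutoff hχ hK hd (M := M)
    (by linarith) (by linarith)).congr (g' := F) fun s _ => by
      simp only [hF]; ring).norm_setIntegral_le zero_lt_one
  have h2 := (((oscBound_mul_Kaux_of_one_lt ht hyx (8 * M)).mul_cutoff hχ hK hd (M := M)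
    (by linarith) (by linarith)).congr (g' := F) fun s _ => by
      simp only [hF]; ring).norm_setIntegral_le (by linarith)
  rw [← integral_Ioc_eq_integral_Ioo] at h1 h2
  by_cases hi : IntegrableOn F (Ioi 0)
  swap
  · rw [integral_undef hi, norm_zero]; positivity
  have h3 : ∫ l in Ioi (8 * M), F l = 0 := by
    refine setIntegral_eq_zero_of_forall_eq_zero fun l hl => ?_
    have hl' : 8 * M < l := hl
    have : χ (l / M) = 0 := hzero _ (by
      rw [abs_of_nonneg (by apply div_nonneg <;> linarith), le_div_iff₀ (by linarith)]
      exact hl'.le)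
    simp [hF, this]
  rw [← Ioc_union_Ioi_eq_Ioi (zero_le_one' ℝ), setIntegral_union (Ioc_disjoint_Ioi le_rfl)
      measurableSet_Ioi (hi.mono_set Ioc_subset_Ioi_self)
      (hi.mono_set (Ioi_subset_Ioi zero_le_one)),
    ← Ioc_union_Ioi_eq_Ioi (by linarith : (1 : ℝ) ≤ 8 * M),
    setIntegral_union (Ioc_disjoint_Ioi le_rfl) measurableSet_Ioi
      (hi.mono_set (Ioc_subset_Ioi_self.trans (Ioi_subset_Ioi zero_le_one)))
      (hi.mono_set (Ioi_subset_Ioi (by linarith))), h3, add_zero]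
  linarith [norm_add_le (∫ l in Ioc 0 1, F l) (∫ l in Ioc 1 (8 * M), F l)]

end Kernel

/-- There is a constant `C > 0` such that for every `M > 1`, every `t ≠ 0` and all `x,y`,
`|∫ e^{itλ²} λ χ(λ/M) K_λ(x,y) dλ| ≤ C |t|^{-1/2}`. -/
theorem stmt0 (χ : ℝ → ℝ) (hsmooth : ContDiff ℝ (⊤ : ℕ∞) χ) (hsupp : HasCompactSupport χ)
    (heven : ∀ l : ℝ, χ (-l) = χ l)
    (hone : ∀ l : ℝ, |l| ≤ 4 → χ l = 1) (hzero : ∀ l : ℝ, 8 ≤ |l| → χ l = 0)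
    (hd1 : ∀ l : ℝ, |deriv χ l| ≤ 1) (hd2 : ∀ l : ℝ, |deriv (deriv χ) l| ≤ 1) :
    ∃ C > (0:ℝ), ∀ M : ℝ, 1 < M → ∀ t : ℝ, t ≠ 0 → ∀ x y : ℝ,
      ‖∫ l : ℝ, Complex.exp (Complex.I * (t : ℂ) * (l : ℂ) ^ 2) * (l : ℂ)
          * (χ (l / M) : ℂ) * Kker l x y‖
        ≤ C * |t| ^ (-(1:ℝ)/2) := by
  have hχ : ContDiff ℝ 1 χ := hsmooth.of_le (by exact_mod_cast le_top)
  obtain ⟨K, hK⟩ := hsupp.exists_bound_of_continuous hχ.continuous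
  have hK' : ∀ l, |χ l| ≤ K := hK
  have hK0 : 0 ≤ K := (abs_nonneg _).trans (hK' 0)
  refine ⟨4 * ((K + 8) * (17 * 18)), by positivity, fun M hM t ht x y => ?_⟩
  obtain ⟨u, v, hvu, hKer⟩ : ∃ u v : ℝ, v ≤ u ∧ ∀ l, Kker l x y = Kaux l u v := by
    by_cases h : y ≤ x
    · exact ⟨x, y, h, fun l => if_pos h⟩
    · exact ⟨y, x, (not_le.1 h).le, fun l => if_neg h⟩
  simp only [hKer]
  have hpow : |t| ^ (-(1:ℝ)/2) = 1 / √|t| := by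
    rw [neg_div, Real.rpow_neg (abs_nonneg t), ← Real.sqrt_eq_rpow, one_div]
  rw [hpow]
  have half := fun (s : ℝ) (hs : s ≠ 0) =>
    norm_setIntegral_Ioi_le hχ hzero hK' hd1 hM hs hvu
  set F : ℝ → ℝ → ℂ := fun s l => Complex.exp (Complex.I * (s : ℂ) * (l : ℂ) ^ 2) * (l : ℂ)
    * (χ (l / M) : ℂ) * Kaux l u v with hF
  have hneg : ∀ l, F t (-l) = -(starRingEnd ℂ) (F (-t) l) := fun l => by
    simp only [hF, Kaux_neg, map_mul, ← Complex.exp_conj, Complex.conj_ofReal, Complex.conj_I,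
      map_pow, neg_div, heven]
    push_cast
    ring_nf
  have hleft : ‖∫ l in Set.Iic (0 : ℝ), F t l‖ = ‖∫ l in Set.Ioi (0 : ℝ), F (-t) l‖ := by
    have := integral_comp_neg_Ioi (0 : ℝ) (F t)
    rw [neg_zero] at this
    rw [← this]
    simp only [hneg]
    rw [integral_neg, integral_conj, norm_neg, RCLike.norm_conj]
  have hpos := half t ht
  have hneg' := half (-t) (neg_ne_zero.2 ht)
  rw [abs_neg] at hneg'
  by_cases hi : Integrable (F t)
  swap
  · rw [integral_undef hi, norm_zero]; positivity
  rw [← intervalIntegral.integral_Iic_add_Ioi hi.integrableOn hi.integrableOn (b := 0)]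
  calc _ ≤ ‖∫ l in Set.Iic (0 : ℝ), F t l‖ + ‖∫ l in Set.Ioi (0 : ℝ), F t l‖ := norm_add_le _ _
    _ ≤ 2 * ((K + 8) * (17 * (18 / √|t|))) + 2 * ((K + 8) * (17 * (18 / √|t|))) := by
      rw [hleft]; exact add_le_add hneg' hpos
    _ = _ := by ring
end

section
/- Let ψ ∈ C^∞(ℝ) with ψ(λ) = 1 for λ ≥ 3 and ψ(λ) = 0 for λ ≤ 2, and let χ be the fixed cutoff. Then sup_{M > 1} ∫_ℝ |∫_ℝ (ψ(λ) χ(λ/M) / (λ + (λ²−1)^{1/2})²) e^{iλA} dλ| dA < ∞; that is, the function A ↦ ∫ ψ(λ)χ(λ/M)(λ+(λ²−1)^{1/2})^{−2} e^{iλA} dλ has L¹(ℝ, dA) norm bounded uniformly in M > 1. -/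
open MeasureTheory Complex

/-- Integration by parts against the character `l ↦ e^{ilA}`. -/
lemma integral_deriv_mul_cexp {f f' : ℝ → ℝ} (hf : ∀ x, HasDerivAt f (f' x) x)
    (hi : Integrable f) (hi' : Integrable f') (A : ℝ) :
    ∫ l : ℝ, (f' l : ℂ) * exp (I * l * A) = -(I * A) * ∫ l : ℝ, (f l : ℂ) * exp (I * l * A) := by
  have hexp : ∀ x : ℝ, HasDerivAt (fun l : ℝ ↦ exp (I * l * A)) (I * A * exp (I * x * A)) x := by
    intro x
    have h : HasDerivAt (fun l : ℝ ↦ I * (l : ℂ) * A) (I * 1 * A) x :=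
      ((hasDerivAt_id x).ofReal_comp.const_mul I).mul_const (A : ℂ)
    convert h.cexp using 1
    ring
  have hint : ∀ {g : ℝ → ℝ}, Integrable g →
      Integrable (fun l : ℝ ↦ (g l : ℂ) * exp (I * l * A)) := by
    intro g hg
    refine hg.ofReal.mul_bdd (c := 1) (by fun_prop) (.of_forall fun x ↦ ?_)
    have : I * (x : ℂ) * A = ((x * A : ℝ) : ℂ) * I := by push_cast; ring
    rw [this, norm_exp_ofReal_mul_I]
  have key := integral_mul_deriv_eq_deriv_mul_of_integrable
    (u := fun l : ℝ ↦ (f l : ℂ)) (v := fun l : ℝ ↦ exp (I * l * A))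
    (fun x _ ↦ (hf x).ofReal_comp) (fun x _ ↦ hexp x)
    (((hint hi).const_mul (I * A)).congr (.of_forall fun x ↦ by
      simp only [Pi.mul_apply]
      ring))
    (hint hi') (hint hi)
  rw [← neg_eq_iff_eq_neg] at key
  rw [← key, neg_mul, ← integral_const_mul]
  congr 2
  ext x
  ring

lemma norm_integral_mul_cexp_le {f : ℝ → ℝ} {D : ℝ} (hb : ∀ x, |f x| ≤ D * (1 + x ^ 2)⁻¹)
    (A : ℝ) : ‖∫ l : ℝ, (f l : ℂ) * exp (I * l * A)‖ ≤ D * Real.pi := by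
  have h := norm_integral_le_of_norm_le (integrable_inv_one_add_sq.const_mul D)
    (f := fun l : ℝ ↦ (f l : ℂ) * exp (I * l * A)) (.of_forall fun x ↦ by
      have : I * (x : ℂ) * A = ((x * A : ℝ) : ℂ) * I := by push_cast; ring
      rw [norm_mul, this, norm_exp_ofReal_mul_I, mul_one, norm_real]
      exact hb x)
  rwa [integral_const_mul, integral_univ_inv_one_add_sq] at h

/-- A function which is `O((1 + x²)⁻¹)` together with its first two derivatives has a Fourier
transform with controlled `L¹` norm. -/
lemma integral_norm_fourier_le {f f₁ f₂ : ℝ → ℝ} {D : ℝ}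
    (h₁ : ∀ x, HasDerivAt f (f₁ x) x) (h₂ : ∀ x, HasDerivAt f₁ (f₂ x) x)
    (hb : ∀ x, |f x| ≤ D * (1 + x ^ 2)⁻¹) (hb₁ : ∀ x, |f₁ x| ≤ D * (1 + x ^ 2)⁻¹)
    (hb₂ : ∀ x, |f₂ x| ≤ D * (1 + x ^ 2)⁻¹) :
    ∫ A : ℝ, ‖∫ l : ℝ, (f l : ℂ) * exp (I * l * A)‖ ≤ 2 * D * Real.pi * Real.pi := by
  have meas : ∀ {g g' : ℝ → ℝ}, (∀ x, HasDerivAt g (g' x) x) → Measurable g' := by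
    intro g g' h
    rw [show g' = deriv g from funext fun x ↦ (h x).deriv.symm]
    exact measurable_deriv g
  have int : ∀ {g : ℝ → ℝ}, Measurable g → (∀ x, |g x| ≤ D * (1 + x ^ 2)⁻¹) → Integrable g :=
    fun hm hg ↦ (integrable_inv_one_add_sq.const_mul D).mono' hm.aestronglyMeasurable
      (.of_forall hg)
  have hi := int (Differentiable.continuous fun x ↦ (h₁ x).differentiableAt).measurable hb
  have hi₁ := int (meas h₁) hb₁
  have hi₂ := int (meas h₂) hb₂
  have bound : ∀ A : ℝ, ‖∫ l : ℝ, (f l : ℂ) * exp (I * l * A)‖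
      ≤ 2 * D * Real.pi * (1 + A ^ 2)⁻¹ := by
    intro A
    have e : ∫ l : ℝ, (f₂ l : ℂ) * exp (I * l * A)
        = -((A ^ 2 : ℝ) : ℂ) * ∫ l : ℝ, (f l : ℂ) * exp (I * l * A) := by
      rw [integral_deriv_mul_cexp h₂ hi₁ hi₂, integral_deriv_mul_cexp h₁ hi hi₁, ← mul_assoc]
      congr 1
      push_cast
      linear_combination (A : ℂ) ^ 2 * I_sq
    have b₀ := norm_integral_mul_cexp_le hb A
    have b₂ := norm_integral_mul_cexp_le hb₂ A
    rw [e, norm_mul, norm_neg, norm_real, Real.norm_of_nonneg (sq_nonneg A)] at b₂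
    rw [← div_eq_mul_inv, le_div_iff₀ (by positivity)]
    linarith
  calc _ ≤ ∫ A : ℝ, 2 * D * Real.pi * (1 + A ^ 2)⁻¹ :=
        integral_mono_of_nonneg (.of_forall fun A ↦ norm_nonneg _)
          (integrable_inv_one_add_sq.const_mul _) (.of_forall bound)
    _ = _ := by rw [integral_const_mul, integral_univ_inv_one_add_sq]

/-- A derivative vanishes on a closed half-line where the function vanishes. -/
lemma HasDerivAt.eq_zero_of_eq_zero_of_le {φ : ℝ → ℝ} {d a x : ℝ} (h : HasDerivAt φ d x)
    (h0 : ∀ y ≤ a, φ y = 0) (hx : x ≤ a) : d = 0 :=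
  (uniqueDiffOn_Iic a x hx).eq_deriv _ h.hasDerivWithinAt
    ((hasDerivWithinAt_const x (Set.Iic a) 0).congr h0 (h0 x hx))

lemma HasDerivAt.mul_of_eq_zero_of_le {φ φ' g g' : ℝ → ℝ} {a b : ℝ} (hab : b < a)
    (hφ : ∀ x, HasDerivAt φ (φ' x) x) (h0 : ∀ x ≤ a, φ x = 0)
    (hg : ∀ x, b < x → HasDerivAt g (g' x) x) (x : ℝ) :
    HasDerivAt (fun x ↦ φ x * g x) (φ' x * g x + φ x * g' x) x := by
  rcases lt_or_ge b x with hx | hx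
  · exact (hφ x).mul (hg x hx)
  · have hxa : x < a := hx.trans_lt hab
    rw [(hφ x).eq_zero_of_eq_zero_of_le h0 hxa.le, h0 x hxa.le, zero_mul, zero_mul, add_zero]
    refine (hasDerivAt_const x (0 : ℝ)).congr_of_eventuallyEq ?_
    filter_upwards [Iio_mem_nhds hxa] with y hy
    rw [h0 y (le_of_lt hy), zero_mul]

lemma hasDerivAt_sqrt_sq_sub_one_s3 {x : ℝ} (hx : 1 < x) :
    HasDerivAt (fun x : ℝ ↦ √(x ^ 2 - 1)) (x / √(x ^ 2 - 1)) x := by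
  have h := (((hasDerivAt_id x).pow 2).sub_const 1).sqrt (by simp only [id, Pi.pow_apply]; nlinarith)
  convert h using 1
  simp only [id, Pi.pow_apply]
  rw [← mul_div_mul_left x _ two_ne_zero]
  simp

/-- The weight `(x + √(x² - 1))⁻²`. -/
noncomputable def coshWeight (x : ℝ) : ℝ := ((x + √(x ^ 2 - 1)) ^ 2)⁻¹

lemma hasDerivAt_coshWeight {x : ℝ} (hx : 1 < x) :
    HasDerivAt coshWeight (-2 * coshWeight x / √(x ^ 2 - 1)) x := by
  have hs : 0 < √(x ^ 2 - 1) := Real.sqrt_pos.2 (by nlinarith)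
  have h := (((hasDerivAt_id x).add (hasDerivAt_sqrt_sq_sub_one_s3 hx)).pow 2).inv
    (by simp only [id, Pi.pow_apply, Pi.add_apply]; positivity)
  refine h.congr_deriv ?_
  simp only [id, Pi.pow_apply, Pi.add_apply, coshWeight]
  field_simp
  ring

lemma hasDerivAt_deriv_coshWeight {x : ℝ} (hx : 1 < x) :
    HasDerivAt (fun x ↦ -2 * coshWeight x / √(x ^ 2 - 1))
      (4 * coshWeight x / √(x ^ 2 - 1) ^ 2 + 2 * coshWeight x * x / √(x ^ 2 - 1) ^ 3) x := by
  have hs : 0 < √(x ^ 2 - 1) := Real.sqrt_pos.2 (by nlinarith)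
  have h := ((hasDerivAt_coshWeight hx).const_mul (-2)).div (hasDerivAt_sqrt_sq_sub_one_s3 hx) hs.ne'
  refine h.congr_deriv ?_
  field_simp
  ring

lemma coshWeight_nonneg (x : ℝ) : 0 ≤ coshWeight x := by
  unfold coshWeight; positivity

lemma coshWeight_le {x : ℝ} (hx : 2 ≤ x) : coshWeight x ≤ 2 * (1 + x ^ 2)⁻¹ := by
  have hs := Real.sqrt_nonneg (x ^ 2 - 1)
  rw [coshWeight, ← div_eq_mul_inv, inv_le_comm₀ (by positivity) (by positivity), inv_div,
    div_le_iff₀ two_pos]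
  nlinarith

lemma abs_deriv_coshWeight_le {x : ℝ} (hx : 2 ≤ x) :
    |-2 * coshWeight x / √(x ^ 2 - 1)| ≤ 2 * coshWeight x := by
  have hs : 1 ≤ √(x ^ 2 - 1) := Real.one_le_sqrt.2 (by nlinarith)
  have hw := coshWeight_nonneg x
  rw [abs_div, abs_mul, abs_of_nonneg hw, abs_of_pos (zero_lt_one.trans_le hs)]
  norm_num
  exact div_le_self (by positivity) hs

lemma abs_deriv_deriv_coshWeight_le {x : ℝ} (hx : 2 ≤ x) :
    |4 * coshWeight x / √(x ^ 2 - 1) ^ 2 + 2 * coshWeight x * x / √(x ^ 2 - 1) ^ 3|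
      ≤ 8 * coshWeight x := by
  have hs : 1 ≤ √(x ^ 2 - 1) := Real.one_le_sqrt.2 (by nlinarith)
  have hw := coshWeight_nonneg x
  have hxs : x ≤ 2 * √(x ^ 2 - 1) := by
    nlinarith [Real.sq_sqrt (show (0 : ℝ) ≤ x ^ 2 - 1 by nlinarith)]
  rw [abs_of_nonneg (by positivity)]
  have a : 4 * coshWeight x / √(x ^ 2 - 1) ^ 2 ≤ 4 * coshWeight x :=
    div_le_self (by positivity) (one_le_pow₀ hs)
  have b : 2 * coshWeight x * x / √(x ^ 2 - 1) ^ 3 ≤ 4 * coshWeight x := by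
    rw [div_le_iff₀ (by positivity)]
    have : √(x ^ 2 - 1) ≤ √(x ^ 2 - 1) ^ 3 := le_self_pow₀ hs (by norm_num)
    nlinarith [mul_le_mul_of_nonneg_left (hxs.trans (mul_le_mul_of_nonneg_left this zero_le_two)) hw]
  linarith

lemma integral_norm_fourier_mul_coshWeight_le {φ φ₁ φ₂ : ℝ → ℝ} {K : ℝ}
    (h₁ : ∀ x, HasDerivAt φ (φ₁ x) x) (h₂ : ∀ x, HasDerivAt φ₁ (φ₂ x) x)
    (h0 : ∀ x ≤ 2, φ x = 0) (hb : ∀ x, |φ x| ≤ K) (hb₁ : ∀ x, |φ₁ x| ≤ K)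
    (hb₂ : ∀ x, |φ₂ x| ≤ K) :
    ∫ A : ℝ, ‖∫ l : ℝ, ((φ l * coshWeight l : ℝ) : ℂ) * exp (I * l * A)‖
      ≤ 2 * (26 * K) * Real.pi * Real.pi := by
  have h0₁ : ∀ x ≤ 2, φ₁ x = 0 := fun x hx ↦ (h₁ x).eq_zero_of_eq_zero_of_le h0 hx
  have h0₂ : ∀ x ≤ 2, φ₂ x = 0 := fun x hx ↦ (h₂ x).eq_zero_of_eq_zero_of_le h0₁ hx
  have hK : 0 ≤ K := (abs_nonneg _).trans (hb 0)
  have weaken : ∀ {x y c : ℝ}, 2 ≤ x → c ≤ 13 → |y| ≤ c * (K * coshWeight x) →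
      |y| ≤ 26 * K * (1 + x ^ 2)⁻¹ := by
    intro x y c hx hc hy
    have a := mul_le_mul_of_nonneg_right hc (mul_nonneg hK (coshWeight_nonneg x))
    have b := mul_le_mul_of_nonneg_left (coshWeight_le hx) hK
    linarith
  refine integral_norm_fourier_le
    (HasDerivAt.mul_of_eq_zero_of_le one_lt_two h₁ h0 fun x ↦ hasDerivAt_coshWeight)
    (fun x ↦ (HasDerivAt.mul_of_eq_zero_of_le one_lt_two h₂ h0₁
      (fun x ↦ hasDerivAt_coshWeight) x).add (HasDerivAt.mul_of_eq_zero_of_le one_lt_two h₁ h0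
      (fun x ↦ hasDerivAt_deriv_coshWeight) x)) (fun x ↦ ?_) (fun x ↦ ?_) (fun x ↦ ?_) <;>
  rcases le_total x 2 with hx | hx
  · rw [h0 x hx, zero_mul, abs_zero]; positivity
  · refine weaken (c := 1) hx (by norm_num) ?_
    rw [abs_mul, abs_of_nonneg (coshWeight_nonneg x), one_mul]
    exact mul_le_mul_of_nonneg_right (hb x) (coshWeight_nonneg x)
  · rw [h0 x hx, h0₁ x hx, zero_mul, zero_mul, add_zero, abs_zero]; positivity
  · refine weaken (c := 3) hx (by norm_num) ?_
    have a := mul_le_mul_of_nonneg_right (hb₁ x) (coshWeight_nonneg x)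
    have b := mul_le_mul (hb x) (abs_deriv_coshWeight_le hx) (abs_nonneg _) hK
    refine (abs_add_le _ _).trans ?_
    rw [abs_mul, abs_mul (φ x), abs_of_nonneg (coshWeight_nonneg x)]
    linarith
  · rw [h0 x hx, h0₁ x hx, h0₂ x hx]
    simp only [zero_mul, add_zero, abs_zero]
    positivity
  · refine weaken (c := 13) hx le_rfl ?_
    have a := mul_le_mul_of_nonneg_right (hb₂ x) (coshWeight_nonneg x)
    have b := mul_le_mul (hb₁ x) (abs_deriv_coshWeight_le hx) (abs_nonneg _) hK
    have c := mul_le_mul (hb x) (abs_deriv_deriv_coshWeight_le hx) (abs_nonneg _) hK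
    refine (abs_add_le _ _).trans ((add_le_add (abs_add_le _ _) (abs_add_le _ _)).trans ?_)
    rw [abs_mul, abs_mul (φ₁ x), abs_mul (φ x), abs_of_nonneg (coshWeight_nonneg x)]
    linarith

/-- A continuous function equal to constants near both ends of the line is bounded. -/
lemma exists_abs_le_of_eq_const {f : ℝ → ℝ} (hf : Continuous f) {a b c d : ℝ}
    (ha : ∀ x ≤ a, f x = c) (hb : ∀ x, b ≤ x → f x = d) : ∃ B, ∀ x, |f x| ≤ B := by
  obtain ⟨B, hB⟩ := isCompact_Icc.exists_bound_of_continuousOn (s := Set.Icc a b) hf.continuousOn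
  refine ⟨max B (max |c| |d|), fun x ↦ ?_⟩
  rcases le_total x a with hx | hx
  · rw [ha x hx]; simp
  rcases le_total b x with hx' | hx'
  · rw [hb x hx']; simp
  exact (hB x ⟨hx, hx'⟩).trans (le_max_left _ _)

/-- With `ψ` smooth, `ψ = 1` on `[3,∞)`, `ψ = 0` on `(−∞,2]`, and `χ` the fixed cutoff,
the `L¹(dA)` norm of `A ↦ ∫ ψ(λ)χ(λ/M)(λ+√(λ²−1))^{−2} e^{iλA} dλ` is bounded
uniformly in `M > 1`. -/
theorem stmt3 (ψ χ : ℝ → ℝ)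
    (hψs : ContDiff ℝ (⊤ : ℕ∞) ψ) (hψ1 : ∀ l : ℝ, 3 ≤ l → ψ l = 1) (hψ0 : ∀ l : ℝ, l ≤ 2 → ψ l = 0)
    (hχs : ContDiff ℝ (⊤ : ℕ∞) χ) (hχsupp : HasCompactSupport χ) (hχeven : ∀ l : ℝ, χ (-l) = χ l)
    (hχone : ∀ l : ℝ, |l| ≤ 4 → χ l = 1) (hχzero : ∀ l : ℝ, 8 ≤ |l| → χ l = 0)
    (hχd1 : ∀ l : ℝ, |deriv χ l| ≤ 1) (hχd2 : ∀ l : ℝ, |deriv (deriv χ) l| ≤ 1) :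
    ∃ C : ℝ, ∀ M : ℝ, 1 < M →
      (∫ A : ℝ,
        ‖∫ l : ℝ, ((ψ l * χ (l / M) / (l + Real.sqrt (l ^ 2 - 1)) ^ 2 : ℝ) : ℂ)
            * Complex.exp (Complex.I * (l : ℂ) * (A : ℂ))‖) ≤ C := by
  have smooth_deriv : ∀ {f : ℝ → ℝ}, ContDiff ℝ (⊤ : ℕ∞) f → ContDiff ℝ (⊤ : ℕ∞) (deriv f) :=
    fun hf ↦ (contDiff_infty_iff_deriv.1 hf).2
  have has_deriv : ∀ {f : ℝ → ℝ}, ContDiff ℝ (⊤ : ℕ∞) f → ∀ x, HasDerivAt f (deriv f x) x :=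
    fun hf x ↦ ((contDiff_infty_iff_deriv.1 hf).1 x).hasDerivAt
  have hψs' := smooth_deriv hψs
  have hψs'' := smooth_deriv hψs'
  have left₁ : ∀ x ≤ 2, deriv ψ x = 0 := fun x hx ↦
    (has_deriv hψs x).eq_zero_of_eq_zero_of_le hψ0 hx
  have left₂ : ∀ x ≤ 2, deriv (deriv ψ) x = 0 := fun x hx ↦
    (has_deriv hψs' x).eq_zero_of_eq_zero_of_le left₁ hx
  have right : ∀ {f : ℝ → ℝ} {c : ℝ}, ContDiff ℝ (⊤ : ℕ∞) f → (∀ x, 3 ≤ x → f x = c) →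
      ∀ x, 3 ≤ x → deriv f x = 0 := fun {f c} hf hc x hx ↦
    (uniqueDiffOn_Ici 3 x hx).eq_deriv _ (has_deriv hf x).hasDerivWithinAt
      ((hasDerivWithinAt_const x (Set.Ici 3) c).congr hc (hc x hx))
  obtain ⟨B₀, hB₀⟩ := exists_abs_le_of_eq_const hψs.continuous hψ0 hψ1
  obtain ⟨B₁, hB₁⟩ := exists_abs_le_of_eq_const hψs'.continuous left₁ (right hψs hψ1)
  obtain ⟨B₂, hB₂⟩ :=
    exists_abs_le_of_eq_const hψs''.continuous left₂ (right hψs' (right hψs hψ1))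
  obtain ⟨E, hE⟩ := exists_abs_le_of_eq_const (a := -8) (b := 8) (c := 0) (d := 0) hχs.continuous
    (fun x hx ↦ hχzero x (by rw [abs_of_nonpos] <;> linarith))
    (fun x hx ↦ hχzero x (hx.trans (le_abs_self x)))
  have nB₀ := (abs_nonneg _).trans (hB₀ 0)
  have nB₁ := (abs_nonneg _).trans (hB₁ 0)
  have nB₂ := (abs_nonneg _).trans (hB₂ 0)
  have nE := (abs_nonneg _).trans (hE 0)
  set B := B₀ + B₁ + B₂ with hB
  set F := E + 1 with hF
  refine ⟨2 * (26 * (4 * (B * F))) * Real.pi * Real.pi, fun M hM ↦ ?_⟩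
  have hM0 : 0 < M := zero_lt_one.trans hM
  have scale : ∀ {f : ℝ → ℝ}, ContDiff ℝ (⊤ : ℕ∞) f → ∀ x,
      HasDerivAt (fun x ↦ f (x / M)) (deriv f (x / M) / M) x := by
    intro f hf x
    have h := (has_deriv hf (x / M)).comp x ((hasDerivAt_id x).div_const M)
    rwa [mul_one_div] at h
  have abs_div_le : ∀ y : ℝ, |y| ≤ 1 → |y / M| ≤ 1 := fun y hy ↦ by
    rw [abs_div, abs_of_pos hM0]
    exact (div_le_self (abs_nonneg y) hM.le).trans hy
  have c₀ : ∀ x, |χ (x / M)| ≤ F := fun x ↦ by linarith [hE (x / M)]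
  have c₁ : ∀ x, |deriv χ (x / M) / M| ≤ F := fun x ↦ by
    linarith [abs_div_le _ (hχd1 (x / M))]
  have c₂ : ∀ x, |deriv (deriv χ) (x / M) / M / M| ≤ F := fun x ↦ by
    linarith [abs_div_le _ (abs_div_le _ (hχd2 (x / M)))]
  have p₀ : ∀ x, |ψ x| ≤ B := fun x ↦ by linarith [hB₀ x]
  have p₁ : ∀ x, |deriv ψ x| ≤ B := fun x ↦ by linarith [hB₁ x]
  have p₂ : ∀ x, |deriv (deriv ψ) x| ≤ B := fun x ↦ by linarith [hB₂ x]
  have prod : ∀ {y z : ℝ}, |y| ≤ B → |z| ≤ F → |y * z| ≤ B * F := fun hy hz ↦ by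
    rw [abs_mul]
    exact mul_le_mul hy hz (abs_nonneg _) (by positivity)
  have nBF : 0 ≤ B * F := by positivity
  have d₁ := scale hχs
  have d₂ := fun x ↦ (scale (smooth_deriv hχs) x).div_const M
  have main := integral_norm_fourier_mul_coshWeight_le (φ := fun x ↦ ψ x * χ (x / M))
    (K := 4 * (B * F))
    (fun x ↦ (has_deriv hψs x).mul (d₁ x))
    (fun x ↦ ((has_deriv hψs' x).mul (d₁ x)).add ((has_deriv hψs x).mul (d₂ x)))
    (fun x hx ↦ by simp only [hψ0 x hx, zero_mul])
    (fun x ↦ by linarith [prod (p₀ x) (c₀ x)])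
    (fun x ↦ (abs_add_le _ _).trans (by linarith [prod (p₁ x) (c₀ x), prod (p₀ x) (c₁ x)]))
    (fun x ↦ (abs_add_le _ _).trans ((add_le_add (abs_add_le _ _) (abs_add_le _ _)).trans (by
      linarith [prod (p₂ x) (c₀ x), prod (p₁ x) (c₁ x), prod (p₀ x) (c₂ x)])))
  simpa only [coshWeight, ← div_eq_mul_inv] using main
end

section
/- Let ψ ∈ C_c^∞(ℝ) be supported in [−1/2, 3]. Then there is a constant C, depending only on ψ, such that for all A > 0, |∫_1^∞ λ ψ(λ) (λ²−1)^{1/2} e^{iλA} dλ| ≤ C min(1, A^{−3/2}). -/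
open MeasureTheory Complex

/-- Two integrations by parts against `e^{ixA}`. -/
lemma integral_mul_cexp_eq {f f' f'' : ℝ → ℝ} {a b A : ℝ} (hab : a ≤ b) (hA : A ≠ 0)
    (hf : ∀ x ∈ Set.Icc a b, HasDerivAt f (f' x) x)
    (hf' : ∀ x ∈ Set.Icc a b, HasDerivAt f' (f'' x) x)
    (hf'' : ContinuousOn f'' (Set.Icc a b)) :
    ∫ x in a..b, (f x : ℂ) * exp (I * x * A) =
      ((f b * exp (I * b * A) / (I * A) - f' b * exp (I * b * A) / (I * A) ^ 2)
        - (f a * exp (I * a * A) / (I * A) - f' a * exp (I * a * A) / (I * A) ^ 2))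
      + (∫ x in a..b, (f'' x : ℂ) * exp (I * x * A)) / (I * A) ^ 2 := by
  have hIA : (I * A : ℂ) ≠ 0 := mul_ne_zero I_ne_zero (by exact_mod_cast hA)
  have hE : ∀ x : ℝ, HasDerivAt (fun y : ℝ => exp (I * y * A)) (exp (I * x * A) * (I * A)) x := by
    intro x
    have h := ((ofRealCLM.hasDerivAt (x := x)).const_mul I).mul_const (A : ℂ)
    simpa using h.cexp
  have hEc : Continuous fun y : ℝ => exp (I * y * A) := by fun_prop
  have cf : ContinuousOn f (Set.Icc a b) := fun x hx => (hf x hx).continuousAt.continuousWithinAt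
  have i1 : IntervalIntegrable (fun x : ℝ => (f x : ℂ) * exp (I * x * A)) volume a b := by
    apply ContinuousOn.intervalIntegrable_of_Icc hab
    exact (continuous_ofReal.comp_continuousOn cf).mul hEc.continuousOn
  have i2 : IntervalIntegrable (fun x : ℝ => (f'' x : ℂ) * exp (I * x * A)) volume a b := by
    apply ContinuousOn.intervalIntegrable_of_Icc hab
    exact (continuous_ofReal.comp_continuousOn hf'').mul hEc.continuousOn
  have key := intervalIntegral.integral_eq_sub_of_hasDerivAt
    (f := fun x : ℝ => (f x : ℂ) * exp (I * x * A) / (I * A)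
      - f' x * exp (I * x * A) / (I * A) ^ 2)
    (f' := fun x : ℝ => (f x : ℂ) * exp (I * x * A) - f'' x * exp (I * x * A) / (I * A) ^ 2)
    (a := a) (b := b) ?_ (i1.sub (i2.div_const _))
  · rw [intervalIntegral.integral_sub i1 (i2.div_const _), intervalIntegral.integral_div] at key
    rw [← key]
    ring
  · intro x hx
    rw [Set.uIcc_of_le hab] at hx
    have h := ((((hf x hx).ofReal_comp.mul (hE x)).div_const (I * A)).sub
      (((hf' x hx).ofReal_comp.mul (hE x)).div_const ((I * A) ^ 2)))
    refine h.congr_deriv ?_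
    generalize (I * A : ℂ) = c at hIA
    field_simp
    ring

lemma norm_integral_mul_cexp_le_add {f f' f'' : ℝ → ℝ} {a b A : ℝ} (hab : a ≤ b) (hA : 0 < A)
    (hf : ∀ x ∈ Set.Icc a b, HasDerivAt f (f' x) x)
    (hf' : ∀ x ∈ Set.Icc a b, HasDerivAt f' (f'' x) x)
    (hf'' : ContinuousOn f'' (Set.Icc a b)) {g : ℝ → ℝ}
    (hg : IntervalIntegrable g volume a b) (hfg : ∀ x ∈ Set.Icc a b, |f'' x| ≤ g x) :
    ‖∫ x in a..b, (f x : ℂ) * exp (I * x * A)‖ ≤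
      (|f b| + |f a|) / A + (|f' b| + |f' a| + ∫ x in a..b, g x) / A ^ 2 := by
  have hE : ∀ x : ℝ, ‖exp (I * x * A)‖ = 1 := fun x => by simp [norm_exp]
  have hint : ‖∫ x in a..b, (f'' x : ℂ) * exp (I * x * A)‖ ≤ ∫ x in a..b, g x := by
    refine intervalIntegral.norm_integral_le_of_norm_le hab (.of_forall fun x hx => ?_) hg
    rw [norm_mul, hE, mul_one, norm_real]
    exact hfg x ⟨hx.1.le, hx.2⟩
  rw [integral_mul_cexp_eq hab hA.ne' hf hf' hf'']
  refine (norm_add_le _ _).trans ?_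
  refine (add_le_add_left ((norm_sub_le _ _).trans
    (add_le_add (norm_sub_le _ _) (norm_sub_le _ _))) _).trans ?_
  simp only [norm_div, norm_mul, norm_pow, hE, norm_I, norm_real, Real.norm_eq_abs,
    abs_of_pos hA, one_mul, mul_one]
  have := div_le_div_of_nonneg_right hint (sq_nonneg A)
  simp only [add_div]
  linarith

lemma norm_integral_mul_cexp_le_of_le {f : ℝ → ℝ} {a b A K : ℝ} (hab : a ≤ b)
    (hf : ∀ x ∈ Set.Icc a b, |f x| ≤ K) :
    ‖∫ x in a..b, (f x : ℂ) * exp (I * x * A)‖ ≤ K * (b - a) := by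
  rw [← abs_of_nonneg (sub_nonneg.2 hab)]
  refine intervalIntegral.norm_integral_le_of_norm_le_const fun x hx => ?_
  rw [Set.uIoc_of_le hab] at hx
  simpa [norm_exp] using hf x ⟨hx.1.le, hx.2⟩

lemma hasDerivAt_sqrt_sub_one {x : ℝ} (hx : 1 < x) :
    HasDerivAt (fun y : ℝ => √(y - 1)) (1 / (2 * √(x - 1))) x :=
  ((hasDerivAt_id x).sub_const 1).sqrt (sub_pos.2 hx).ne'

/-- Decay `A^{-3/2}` of an oscillatory integral whose amplitude has a square root singularity
at the left endpoint and vanishes at the right endpoint. -/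
lemma norm_integral_mul_sqrt_mul_cexp_le {G G' G'' : ℝ → ℝ} {M A : ℝ} (hA : 1 ≤ A)
    (hG : ∀ x ∈ Set.Icc (1 : ℝ) 4, HasDerivAt G (G' x) x)
    (hG' : ∀ x ∈ Set.Icc (1 : ℝ) 4, HasDerivAt G' (G'' x) x)
    (hG'' : ContinuousOn G'' (Set.Icc 1 4))
    (bG : ∀ x ∈ Set.Icc (1 : ℝ) 4, |G x| ≤ M)
    (bG' : ∀ x ∈ Set.Icc (1 : ℝ) 4, |G' x| ≤ M)
    (bG'' : ∀ x ∈ Set.Icc (1 : ℝ) 4, |G'' x| ≤ M) (hG4 : G 4 = 0) :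
    ‖∫ x in (1 : ℝ)..4, ((G x * √(x - 1) : ℝ) : ℂ) * exp (I * x * A)‖ ≤ 54 * M / √A ^ 3 := by
  have hM : 0 ≤ M := (abs_nonneg _).trans (bG 1 (by norm_num))
  obtain ⟨s, hs, rfl⟩ : ∃ s : ℝ, 1 ≤ s ∧ A = s ^ 2 :=
    ⟨√A, Real.one_le_sqrt.2 hA, (Real.sq_sqrt (by linarith)).symm⟩
  have hs0 : 0 < s := by linarith
  rw [Real.sqrt_sq hs0.le]
  set a : ℝ := 1 + 1 / s ^ 2 with ha
  have h1a : 1 < a := by rw [ha]; linarith [show 0 < 1 / s ^ 2 by positivity]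
  have ha4 : a ≤ 4 := by
    have : 1 / s ^ 2 ≤ 1 := by rw [div_le_one (by positivity)]; nlinarith
    linarith
  have hra : √(a - 1) = 1 / s := by
    rw [ha, show 1 + 1 / s ^ 2 - 1 = (1 / s) ^ 2 by ring, Real.sqrt_sq (by positivity)]
  have hpos : ∀ x ∈ Set.Icc a 4, 0 < √(x - 1) := fun x hx =>
    Real.sqrt_pos.2 (by linarith [hx.1])
  have hle : ∀ x ≤ (4 : ℝ), √(x - 1) ≤ 2 := fun x hx =>
    Real.sqrt_le_iff.2 ⟨by norm_num, by linarith⟩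
  have hsub : ∀ x ∈ Set.Icc a 4, x ∈ Set.Icc (1 : ℝ) 4 := fun x hx => ⟨h1a.le.trans hx.1, hx.2⟩
  have cr : ContinuousOn (fun x : ℝ => √(x - 1)) (Set.Icc a 4) := by fun_prop
  set f : ℝ → ℝ := fun x => G x * √(x - 1) with hf
  set f' : ℝ → ℝ := fun x => G' x * √(x - 1) + G x / (2 * √(x - 1)) with hf'
  set f'' : ℝ → ℝ := fun x => G'' x * √(x - 1) + G' x / √(x - 1) - G x / (4 * √(x - 1) ^ 3)
    with hf''
  have cG : ContinuousOn G (Set.Icc 1 4) := fun x hx => (hG x hx).continuousAt.continuousWithinAt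
  have cG' : ContinuousOn G' (Set.Icc 1 4) :=
    fun x hx => (hG' x hx).continuousAt.continuousWithinAt
  have df : ∀ x ∈ Set.Icc a 4, HasDerivAt f (f' x) x := fun x hx => by
    refine ((hG x (hsub x hx)).mul (hasDerivAt_sqrt_sub_one (h1a.trans_le hx.1))).congr_deriv ?_
    simp only [hf']
    ring
  have df' : ∀ x ∈ Set.Icc a 4, HasDerivAt f' (f'' x) x := fun x hx => by
    have hr := hasDerivAt_sqrt_sub_one (h1a.trans_le hx.1)
    have h0 := (hpos x hx).ne'
    refine (((hG' x (hsub x hx)).mul hr).add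
      ((hG x (hsub x hx)).div (hr.const_mul 2) (mul_ne_zero two_ne_zero h0))).congr_deriv ?_
    simp only [hf'']
    field_simp
    ring
  have cf'' : ContinuousOn f'' (Set.Icc a 4) :=
    (((hG''.mono hsub).mul cr).add ((cG'.mono hsub).div cr fun x hx => (hpos x hx).ne')).sub
      ((cG.mono hsub).div (continuousOn_const.mul (cr.pow 3)) fun x hx => by
        have := hpos x hx; positivity)
  have bf' : ∀ x ∈ Set.Icc a 4, |f' x| ≤ 5 * M / √(x - 1) := fun x hx => by
    have h0 := hpos x hx
    have h2 := hle x hx.2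
    have e : f' x = (G' x * √(x - 1) ^ 2 + G x / 2) / √(x - 1) := by
      simp only [hf']; field_simp
    rw [e, abs_div, abs_of_pos h0]
    gcongr
    refine (abs_add_le _ _).trans ?_
    rw [abs_mul, abs_div, abs_of_pos (pow_pos h0 2), abs_two]
    have := mul_le_mul (bG' x (hsub x hx)) (show √(x - 1) ^ 2 ≤ 4 by nlinarith)
      (by positivity) hM
    linarith [bG x (hsub x hx)]
  have bf'' : ∀ x ∈ Set.Icc a 4, |f'' x| ≤ 21 * M / √(x - 1) ^ 3 := fun x hx => by
    have h0 := hpos x hx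
    have h2 := hle x hx.2
    have e : f'' x = (G'' x * √(x - 1) ^ 4 + G' x * √(x - 1) ^ 2 - G x / 4) / √(x - 1) ^ 3 := by
      simp only [hf'']; field_simp
    rw [e, abs_div, abs_of_pos (pow_pos h0 3)]
    gcongr
    refine (abs_sub _ _).trans ((add_le_add_left (abs_add_le _ _) _).trans ?_)
    rw [abs_mul, abs_mul, abs_div, abs_of_pos (pow_pos h0 2), abs_of_pos (pow_pos h0 4),
      abs_of_pos (by norm_num : (0 : ℝ) < 4)]
    have hsq : √(x - 1) ^ 2 ≤ 4 := by nlinarith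
    have h1 := mul_le_mul (bG' x (hsub x hx)) hsq (by positivity) hM
    have h2 := mul_le_mul (bG'' x (hsub x hx)) (show √(x - 1) ^ 4 ≤ 16 by nlinarith)
      (by positivity) hM
    linarith [bG x (hsub x hx)]
  have ig : IntervalIntegrable (fun x => 21 * M / √(x - 1) ^ 3) volume a 4 :=
    ContinuousOn.intervalIntegrable_of_Icc ha4 <|
      continuousOn_const.div (cr.pow 3) fun x hx => (pow_pos (hpos x hx) 3).ne'
  have hig : ∫ x in a..4, 21 * M / √(x - 1) ^ 3 ≤ 42 * M * s := by
    rw [intervalIntegral.integral_eq_sub_of_hasDerivAt (f := fun x => -(42 * M) / √(x - 1)) ?_ ig]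
    · simp only [hra]
      have : 0 ≤ 42 * M / √(4 - 1) := by positivity
      rw [div_div_eq_mul_div, neg_div]
      linarith
    · intro x hx
      rw [Set.uIcc_of_le ha4] at hx
      have h0 := (hpos x hx).ne'
      refine ((hasDerivAt_const x (-(42 * M))).div
        (hasDerivAt_sqrt_sub_one (h1a.trans_le hx.1)) h0).congr_deriv ?_
      field_simp
      ring
  have cfull : ContinuousOn (fun x : ℝ => ((f x : ℝ) : ℂ) * exp (I * x * ((s ^ 2 : ℝ) : ℂ)))
      (Set.Icc 1 4) := by
    refine (continuous_ofReal.comp_continuousOn (cG.mul ?_)).mul ?_ <;> fun_prop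
  have hfirst : ‖∫ x in (1 : ℝ)..a, (f x : ℂ) * exp (I * x * ((s ^ 2 : ℝ) : ℂ))‖ ≤ M / s ^ 3 := by
    refine (norm_integral_mul_cexp_le_of_le (K := M * (1 / s)) h1a.le fun x hx => ?_).trans_eq ?_
    · rw [hf, abs_mul, abs_of_nonneg (Real.sqrt_nonneg _), ← hra]
      exact mul_le_mul (bG x ⟨hx.1, hx.2.trans ha4⟩) (Real.sqrt_le_sqrt (by linarith [hx.2]))
        (Real.sqrt_nonneg _) hM
    · rw [ha]
      field_simp
      ring
  have hfa : |f a| ≤ M / s := by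
    rw [hf, abs_mul, hra, abs_of_pos (by positivity : 0 < 1 / s), mul_one_div]
    gcongr
    exact bG a ⟨h1a.le, ha4⟩
  have hf'a : |f' a| ≤ 5 * M * s := by
    simpa [hra] using bf' a ⟨le_rfl, ha4⟩
  have hf'4 : |f' 4| ≤ 5 * M * s := by
    refine (bf' 4 ⟨ha4, le_rfl⟩).trans ((div_le_self (by positivity) ?_).trans ?_)
    · exact Real.one_le_sqrt.2 (by norm_num)
    · exact le_mul_of_one_le_right (by positivity) hs
  have hf4 : f 4 = 0 := by simp [hf, hG4]
  have hsecond := norm_integral_mul_cexp_le_add ha4 (pow_pos hs0 2) df df' cf'' ig bf''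
  have hsecond' : (|f 4| + |f a|) / s ^ 2
      + (|f' 4| + |f' a| + ∫ x in a..4, 21 * M / √(x - 1) ^ 3) / (s ^ 2) ^ 2 ≤
      (0 + M / s) / s ^ 2 + (5 * M * s + 5 * M * s + 42 * M * s) / (s ^ 2) ^ 2 := by
    rw [hf4, abs_zero]
    gcongr
  rw [← intervalIntegral.integral_add_adjacent_intervals (b := a)
    (ContinuousOn.intervalIntegrable_of_Icc h1a.le
      (cfull.mono (Set.Icc_subset_Icc_right ha4)))
    (ContinuousOn.intervalIntegrable_of_Icc ha4 (cfull.mono hsub))]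
  refine (norm_add_le _ _).trans ((add_le_add hfirst (hsecond.trans hsecond')).trans_eq ?_)
  field_simp
  ring

/-- If `ψ ∈ C_c^∞(ℝ)` is supported in `[−1/2, 3]`, there is a constant `C` (depending only
on `ψ`) with `|∫_1^∞ λ ψ(λ) √(λ²−1) e^{iλA} dλ| ≤ C min(1, A^{−3/2})` for all `A > 0`. -/
theorem stmt4 (ψ : ℝ → ℝ) (hs : ContDiff ℝ (⊤ : ℕ∞) ψ) (hc : HasCompactSupport ψ)
    (hsupp : Function.support ψ ⊆ Set.Icc (-(1:ℝ)/2) 3) :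
    ∃ C : ℝ, ∀ A : ℝ, 0 < A →
      ‖∫ l in Set.Ioi (1:ℝ),
          ((l * ψ l * Real.sqrt (l ^ 2 - 1) : ℝ) : ℂ)
            * Complex.exp (Complex.I * (l : ℂ) * (A : ℂ))‖
        ≤ C * min 1 (A ^ (-(3:ℝ)/2)) := by
  have hψ : ∀ x, 3 < x → ψ x = 0 := fun x hx => by
    by_contra h
    exact absurd (hsupp h).2 (not_le.2 hx)
  set G : ℝ → ℝ := fun x => x * ψ x * √(x + 1) with hGdef
  have hsm : ContDiffOn ℝ (⊤ : ℕ∞) G (Set.Ioi 0) :=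
    ((contDiff_id.mul hs).contDiffOn).mul <|
      (contDiff_id.add contDiff_const).contDiffOn.sqrt fun x hx => by
        have : (0 : ℝ) < x := hx
        simp only [id]
        positivity
  have hsm' : ContDiffOn ℝ (⊤ : ℕ∞) (deriv G) (Set.Ioi 0) :=
    hsm.deriv_of_isOpen isOpen_Ioi (by simp)
  have hsm'' : ContDiffOn ℝ (⊤ : ℕ∞) (deriv (deriv G)) (Set.Ioi 0) :=
    hsm'.deriv_of_isOpen isOpen_Ioi (by simp)
  have hd : ∀ F : ℝ → ℝ, ContDiffOn ℝ (⊤ : ℕ∞) F (Set.Ioi 0) →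
      ∀ x ∈ Set.Icc (1 : ℝ) 4, HasDerivAt F (deriv F x) x := fun F hF x hx =>
    ((hF.differentiableOn (by simp)).differentiableAt
      (Ioi_mem_nhds (by linarith [hx.1]))).hasDerivAt
  have hIcc : Set.Icc (1 : ℝ) 4 ⊆ Set.Ioi 0 := fun x hx => by
    exact lt_of_lt_of_le one_pos hx.1
  obtain ⟨M₀, h₀⟩ := isCompact_Icc.exists_bound_of_continuousOn (hsm.continuousOn.mono hIcc)
  obtain ⟨M₁, h₁⟩ := isCompact_Icc.exists_bound_of_continuousOn (hsm'.continuousOn.mono hIcc)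
  obtain ⟨M₂, h₂⟩ := isCompact_Icc.exists_bound_of_continuousOn (hsm''.continuousOn.mono hIcc)
  set M := max M₀ (max M₁ M₂)
  have b₀ : ∀ x ∈ Set.Icc (1 : ℝ) 4, |G x| ≤ M := fun x hx =>
    (h₀ x hx).trans (le_max_left _ _)
  have b₁ : ∀ x ∈ Set.Icc (1 : ℝ) 4, |deriv G x| ≤ M := fun x hx =>
    (h₁ x hx).trans ((le_max_left _ _).trans (le_max_right _ _))
  have b₂ : ∀ x ∈ Set.Icc (1 : ℝ) 4, |deriv (deriv G) x| ≤ M := fun x hx =>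
    (h₂ x hx).trans ((le_max_right _ _).trans (le_max_right _ _))
  have hM : 0 ≤ M := (abs_nonneg _).trans (b₀ 1 (by norm_num))
  refine ⟨54 * M, fun A hA => ?_⟩
  have hI : ∫ l in Set.Ioi (1:ℝ), ((l * ψ l * √(l ^ 2 - 1) : ℝ) : ℂ) * exp (I * l * A) =
      ∫ x in (1 : ℝ)..4, ((G x * √(x - 1) : ℝ) : ℂ) * exp (I * x * A) := by
    rw [intervalIntegral.integral_of_le (by norm_num),
      ← setIntegral_eq_of_subset_of_forall_sdiff_eq_zero measurableSet_Ioi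
        Set.Ioc_subset_Ioi_self]
    · refine setIntegral_congr_fun measurableSet_Ioi fun x hx => ?_
      have hx : (1 : ℝ) < x := hx
      simp only [hGdef]
      rw [mul_assoc _ √(x + 1), ← Real.sqrt_mul (by linarith),
        show (x + 1) * (x - 1) = x ^ 2 - 1 by ring]
    · intro x hx
      have : 4 < x := by
        by_contra h
        exact hx.2 ⟨hx.1, not_lt.1 h⟩
      simp [hGdef, hψ x (by linarith)]
  rw [hI]
  rcases le_total A 1 with h | h
  · rw [min_eq_left (Real.one_le_rpow_of_pos_of_le_one_of_nonpos hA h (by norm_num)), mul_one]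
    refine (norm_integral_mul_cexp_le_of_le (f := fun x => G x * √(x - 1)) (K := M * 2)
      (by norm_num) fun x hx => ?_).trans (by linarith)
    rw [abs_mul, abs_of_nonneg (Real.sqrt_nonneg _)]
    exact mul_le_mul (b₀ x hx) (Real.sqrt_le_iff.2 ⟨by norm_num, by linarith [hx.2]⟩)
      (Real.sqrt_nonneg _) hM
  · rw [min_eq_right (Real.rpow_le_one_of_one_le_of_nonpos h (by norm_num))]
    refine (norm_integral_mul_sqrt_mul_cexp_le h (hd G hsm) (hd _ hsm')
      (hsm''.continuousOn.mono hIcc) b₀ b₁ b₂ ?_).trans_eq ?_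
    · simp [hGdef, hψ 4 (by norm_num)]
    · rw [div_eq_mul_inv, Real.sqrt_eq_rpow, ← Real.rpow_natCast, ← Real.rpow_mul hA.le,
        ← Real.rpow_neg hA.le]
      norm_num
end

section
/- There exists an absolute constant C ≤ 120 such that for all x, y > 0 and all real t ≠ 0, |∫_{−1}^{1} (λ/(λ + i(1−λ²)^{1/2})) e^{−(1−λ²)^{1/2} x} e^{iλy} e^{itλ²} dλ| ≤ C |t|^{−1/2}. -/
open MeasureTheory Complex

open Set intervalIntegral in
/-- Abel-type bound: integrating against a monotone weight costs at most its size plus its total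
variation. -/
theorem norm_integral_mul_le_of_monotoneOn {f : ℝ → ℝ} {g : ℝ → ℂ} {a b M : ℝ} (hab : a ≤ b)
    (hfc : ContinuousOn f (Icc a b)) (hfd : ∀ x ∈ Ioo a b, DifferentiableAt ℝ f x)
    (hf : MonotoneOn f (Icc a b)) (hg : Continuous g)
    (hM : ∀ c ∈ Icc a b, ‖∫ u in a..c, g u‖ ≤ M) :
    ‖∫ u in a..b, (f u : ℂ) * g u‖ ≤ (|f b| + |f b - f a|) * M := by
  have hderiv : ∀ x ∈ Ioo a b, HasDerivAt f (deriv f x) x := fun x hx => (hfd x hx).hasDerivAt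
  have hpos : ∀ x ∈ Ioo a b, 0 ≤ deriv f x := fun x hx => by
    rw [← derivWithin_of_mem_nhds (Icc_mem_nhds hx.1 hx.2)]
    exact hf.derivWithin_nonneg
  have hint : IntervalIntegrable (deriv f) volume a b :=
    intervalIntegrable_deriv_of_nonneg (by rwa [uIcc_of_le hab])
      (by rwa [min_eq_left hab, max_eq_right hab]) (by rwa [min_eq_left hab, max_eq_right hab])
  have hint' : IntervalIntegrable (fun x => ((deriv f x : ℝ) : ℂ)) volume a b :=
    ⟨hint.1.ofReal, hint.2.ofReal⟩
  have hG : ∀ x, HasDerivAt (fun c => ∫ u in a..c, g u) (g x) x := fun x =>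
    hg.integral_hasStrictDerivAt a x |>.hasDerivAt
  have hparts := integral_mul_deriv_eq_deriv_mul_of_hasDerivAt
    (u := fun x => (f x : ℂ)) (v := fun c => ∫ u in a..c, g u)
    (u' := fun x => ((deriv f x : ℝ) : ℂ)) (v' := g) (a := a) (b := b)
    (by rw [uIcc_of_le hab]; exact Complex.continuous_ofReal.comp_continuousOn hfc)
    (fun x _ => (hG x).continuousAt.continuousWithinAt)
    (by
      rw [min_eq_left hab, max_eq_right hab]
      exact fun x hx => (hderiv x hx).ofReal_comp)
    (fun x _ => hG x) hint' (hg.intervalIntegrable a b)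
  have hFTC : ∫ u in a..b, deriv f u = f b - f a :=
    integral_eq_sub_of_hasDerivAt_of_le hab hfc hderiv hint
  have hmono : f a ≤ f b := hf (left_mem_Icc.2 hab) (right_mem_Icc.2 hab) hab
  have hrest : ‖∫ u in a..b, ((deriv f u : ℝ) : ℂ) * ∫ s in a..u, g s‖ ≤ (f b - f a) * M := by
    rw [← hFTC, ← intervalIntegral.integral_mul_const]
    refine norm_integral_le_of_norm_le hab ?_ (hint.mul_const M)
    filter_upwards [Measure.ae_ne volume b] with u hub hu
    have hu' : u ∈ Ioo a b := ⟨hu.1, lt_of_le_of_ne hu.2 hub⟩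
    rw [norm_mul, Complex.norm_real, Real.norm_of_nonneg (hpos u hu')]
    exact mul_le_mul_of_nonneg_left (hM u ⟨hu.1.le, hu.2⟩) (hpos u hu')
  rw [hparts]
  simp only [integral_same, mul_zero, sub_zero]
  calc _ ≤ _ := norm_sub_le _ _
    _ ≤ |f b| * M + (f b - f a) * M := by
      refine add_le_add ?_ hrest
      rw [norm_mul, Complex.norm_real, Real.norm_eq_abs]
      exact mul_le_mul_of_nonneg_left (hM b (right_mem_Icc.2 hab)) (abs_nonneg _)
    _ = _ := by rw [abs_of_nonneg (sub_nonneg.2 hmono)]; ring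

open Set in
theorem norm_integral_mul_le_of_antitoneOn {f : ℝ → ℝ} {g : ℝ → ℂ} {a b M : ℝ} (hab : a ≤ b)
    (hfc : ContinuousOn f (Icc a b)) (hfd : ∀ x ∈ Ioo a b, DifferentiableAt ℝ f x)
    (hf : AntitoneOn f (Icc a b)) (hg : Continuous g)
    (hM : ∀ c ∈ Icc a b, ‖∫ u in a..c, g u‖ ≤ M) :
    ‖∫ u in a..b, (f u : ℂ) * g u‖ ≤ (|f b| + |f b - f a|) * M := by
  have h := norm_integral_mul_le_of_monotoneOn (f := fun x => -f x) hab hfc.neg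
    (fun x hx => (hfd x hx).neg) hf.neg hg hM
  have hsub : |-f b - -f a| = |f b - f a| := by rw [← abs_neg]; congr 1; ring
  simp only [hsub, abs_neg, Complex.ofReal_neg, neg_mul, intervalIntegral.integral_neg,
    norm_neg] at h
  exact h

/-- The Fresnel integral over `[0, c]` is `O(|t|^{-1/2})`. -/
theorem norm_integral_fresnel_le {t c : ℝ} (ht : t ≠ 0) (hc : 0 ≤ c) :
    ‖∫ u in (0:ℝ)..c, Complex.exp (Complex.I * t * (u : ℂ) ^ 2)‖ ≤ 2 * |t| ^ (-(1:ℝ)/2) := by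
  have ht' : 0 < |t| := abs_pos.2 ht
  set d : ℝ := |t| ^ (-(1:ℝ)/2) with hd
  have hd0 : 0 < d := Real.rpow_pos_of_pos ht' _
  have hdd : d * d * |t| = 1 := by
    rw [hd, ← Real.rpow_add ht', ← Real.rpow_add_one ht'.ne']
    norm_num
  have hcont : Continuous fun u : ℝ => Complex.exp (Complex.I * t * (u : ℂ) ^ 2) := by fun_prop
  have hnorm : ∀ u : ℝ, ‖Complex.exp (Complex.I * t * (u : ℂ) ^ 2)‖ = 1 := fun u => by
    rw [show Complex.I * t * (u : ℂ) ^ 2 = ((t * u ^ 2 : ℝ) : ℂ) * Complex.I by push_cast; ring]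
    exact Complex.norm_exp_ofReal_mul_I _
  have htriv : ∀ e, 0 ≤ e → ‖∫ u in (0:ℝ)..e, Complex.exp (Complex.I * t * (u : ℂ) ^ 2)‖ ≤ e :=
    fun e he => by
      have := intervalIntegral.norm_integral_le_of_norm_le_const (a := 0) (b := e)
        (f := fun u : ℝ => Complex.exp (Complex.I * t * (u : ℂ) ^ 2)) (C := 1)
        (fun u _ => (hnorm u).le)
      simpa [abs_of_nonneg he] using this
  rcases le_total c d with hcd | hdc
  · linarith [htriv c hc]
  rw [← intervalIntegral.integral_add_adjacent_intervals (b := d)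
    (hcont.intervalIntegrable _ _) (hcont.intervalIntegrable _ _)]
  have hM : ∀ e ∈ Set.Icc d c, ‖∫ u in d..e, 2 * (u : ℂ) *
      Complex.exp (Complex.I * t * (u : ℂ) ^ 2)‖ ≤ 2 / |t| := fun e _ => by
    have htC : Complex.I * (t : ℂ) ≠ 0 := by simp [ht]
    have hprim : ∀ u : ℝ, HasDerivAt
        (fun u : ℝ => Complex.exp (Complex.I * t * (u : ℂ) ^ 2) / (Complex.I * t))
        (2 * (u : ℂ) * Complex.exp (Complex.I * t * (u : ℂ) ^ 2)) u := fun u => by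
      have h1 : HasDerivAt (fun z : ℂ => Complex.exp (Complex.I * t * z ^ 2) / (Complex.I * t))
          (2 * (u : ℂ) * Complex.exp (Complex.I * t * (u : ℂ) ^ 2)) (u : ℂ) := by
        have h2 := (((hasDerivAt_pow 2 (u : ℂ)).const_mul (Complex.I * t)).cexp).div_const
          (Complex.I * t)
        refine h2.congr_deriv ?_
        rw [div_eq_iff htC]
        push_cast
        ring
      exact h1.comp_ofReal
    rw [intervalIntegral.integral_eq_sub_of_hasDerivAt (fun u _ => hprim u)
      ((by fun_prop : Continuous fun u : ℝ => 2 * (u : ℂ) *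
        Complex.exp (Complex.I * t * (u : ℂ) ^ 2)).intervalIntegrable _ _), ← sub_div, norm_div]
    simp only [norm_mul, Complex.norm_I, Complex.norm_real, Real.norm_eq_abs, one_mul]
    gcongr
    calc _ ≤ _ := norm_sub_le _ _
      _ = 2 := by rw [hnorm, hnorm]; norm_num
  have htail := norm_integral_mul_le_of_antitoneOn (f := fun u => 1 / (2 * u)) hdc
    (fun u hu => ContinuousAt.continuousWithinAt (by
      have : 2 * u ≠ 0 := by linarith [hu.1]
      fun_prop (disch := assumption)))
    (fun u hu => by
      have : 2 * u ≠ 0 := by linarith [hu.1]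
      fun_prop (disch := assumption))
    (fun u hu v hv huv => by
      have : 0 < u := hd0.trans_le hu.1
      dsimp only
      gcongr) (by fun_prop) hM
  have htail_eq : ∀ u ∈ Set.uIcc d c, ((1 / (2 * u) : ℝ) : ℂ) * (2 * (u : ℂ) *
      Complex.exp (Complex.I * t * (u : ℂ) ^ 2)) = Complex.exp (Complex.I * t * (u : ℂ) ^ 2) :=
    fun u hu => by
      rw [Set.uIcc_of_le hdc] at hu
      have : (u : ℂ) ≠ 0 := by exact_mod_cast (hd0.trans_le hu.1).ne'
      push_cast
      field_simp
  rw [intervalIntegral.integral_congr htail_eq] at htail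
  have hc0 : 0 < c := hd0.trans_le hdc
  have hle : 1 / (2 * c) ≤ 1 / (2 * d) := by gcongr
  have hval : (|1 / (2 * c)| + |1 / (2 * c) - 1 / (2 * d)|) * (2 / |t|) = d := by
    rw [abs_of_pos (by positivity), abs_of_nonpos (by linarith)]
    field_simp
    linear_combination -c * hdd
  rw [hval] at htail
  linarith [norm_add_le (∫ u in (0:ℝ)..d, Complex.exp (Complex.I * t * (u : ℂ) ^ 2))
    (∫ u in d..c, Complex.exp (Complex.I * t * (u : ℂ) ^ 2)), htriv d hd0.le]

theorem norm_integral_fresnel_le' {t : ℝ} (ht : t ≠ 0) (c : ℝ) :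
    ‖∫ u in (0:ℝ)..c, Complex.exp (Complex.I * t * (u : ℂ) ^ 2)‖ ≤ 2 * |t| ^ (-(1:ℝ)/2) := by
  rcases le_total 0 c with hc | hc
  · exact norm_integral_fresnel_le ht hc
  · have h := norm_integral_fresnel_le ht (neg_nonneg.2 hc)
    have hneg := intervalIntegral.integral_comp_neg (a := c) (b := 0)
      (fun u : ℝ => Complex.exp (Complex.I * t * (u : ℂ) ^ 2))
    simp only [Complex.ofReal_neg, neg_sq, neg_zero] at hneg
    rwa [intervalIntegral.integral_symm, norm_neg, hneg]

/-- Van der Corput's bound for quadratic phases. -/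
theorem norm_integral_quadratic_phase_le {t : ℝ} (ht : t ≠ 0) (y c : ℝ) :
    ‖∫ l in (0:ℝ)..c, Complex.exp (Complex.I * l * y) * Complex.exp (Complex.I * t * (l : ℂ) ^ 2)‖
      ≤ 4 * |t| ^ (-(1:ℝ)/2) := by
  have htC : (t : ℂ) ≠ 0 := by exact_mod_cast ht
  have hsq : ∀ l : ℝ, Complex.exp (Complex.I * l * y) * Complex.exp (Complex.I * t * (l : ℂ) ^ 2)
      = Complex.exp (((-(y ^ 2 / (4 * t)) : ℝ) : ℂ) * Complex.I) *
        Complex.exp (Complex.I * t * ((l + y / (2 * t) : ℝ) : ℂ) ^ 2) := fun l => by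
    rw [← Complex.exp_add, ← Complex.exp_add]
    congr 1
    push_cast
    field_simp
    ring
  have hcont : Continuous fun u : ℝ => Complex.exp (Complex.I * t * (u : ℂ) ^ 2) := by fun_prop
  simp_rw [hsq]
  rw [intervalIntegral.integral_const_mul, norm_mul, Complex.norm_exp_ofReal_mul_I, one_mul,
    intervalIntegral.integral_comp_add_right
      (fun u : ℝ => Complex.exp (Complex.I * t * (u : ℂ) ^ 2)),
    ← intervalIntegral.integral_interval_sub_left (a := 0) (hcont.intervalIntegrable _ _)
      (hcont.intervalIntegrable _ _)]
  refine (norm_sub_le _ _).trans ?_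
  linarith [norm_integral_fresnel_le' ht (c + y / (2 * t)),
    norm_integral_fresnel_le' ht (0 + y / (2 * t))]

open Set in
/-- A continuous weight on `[0, 1]` with values in `[0, 1]`, monotone or antitone, at most doubles
a uniform bound on primitives. -/
theorem norm_integral_unit_weight_mul_le {f : ℝ → ℝ} {g : ℝ → ℂ} {M : ℝ}
    (hfc : Continuous f) (hfd : ∀ x ∈ Ioo (0:ℝ) 1, DifferentiableAt ℝ f x)
    (hf : MonotoneOn f (Icc 0 1) ∨ AntitoneOn f (Icc 0 1))
    (hf01 : ∀ x ∈ Icc (0:ℝ) 1, f x ∈ Icc (0:ℝ) 1) (hg : Continuous g)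
    (hM : ∀ c ∈ Icc (0:ℝ) 1, ‖∫ u in (0:ℝ)..c, g u‖ ≤ M) :
    ∀ c ∈ Icc (0:ℝ) 1, ‖∫ u in (0:ℝ)..c, (f u : ℂ) * g u‖ ≤ 2 * M := fun c hc => by
  have hsub : Icc 0 c ⊆ Icc (0:ℝ) 1 := Icc_subset_Icc_right hc.2
  have hfd' : ∀ x ∈ Ioo 0 c, DifferentiableAt ℝ f x :=
    fun x hx => hfd x ⟨hx.1, hx.2.trans_le hc.2⟩
  have hM' : ∀ e ∈ Icc 0 c, ‖∫ u in (0:ℝ)..e, g u‖ ≤ M := fun e he => hM e (hsub he)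
  have hM0 : 0 ≤ M := (norm_nonneg _).trans (hM 0 (by simp))
  have h0 := hf01 0 (by simp)
  have h1 := hf01 c hc
  have hvar : |f c| + |f c - f 0| ≤ 2 := by
    have : |f c| ≤ 1 := abs_le.2 ⟨by linarith [h1.1], h1.2⟩
    have : |f c - f 0| ≤ 1 := abs_le.2 ⟨by linarith [h1.1, h0.2], by linarith [h1.2, h0.1]⟩
    linarith
  refine le_trans ?_ (mul_le_mul_of_nonneg_right hvar hM0)
  rcases hf with hf | hf
  · exact norm_integral_mul_le_of_monotoneOn hc.1 hfc.continuousOn hfd' (hf.mono hsub) hg hM'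
  · exact norm_integral_mul_le_of_antitoneOn hc.1 hfc.continuousOn hfd' (hf.mono hsub) hg hM'

theorem antitoneOn_sqrt_one_sub_sq :
    AntitoneOn (fun l : ℝ => √(1 - l ^ 2)) (Set.Icc 0 1) := fun u hu v _ huv => by
  have := hu.1
  dsimp only
  gcongr

theorem differentiableAt_sqrt_one_sub_sq {l : ℝ} (hl : l ∈ Set.Ioo (0:ℝ) 1) :
    DifferentiableAt ℝ (fun l : ℝ => √(1 - l ^ 2)) l := by
  have : 1 - l ^ 2 ≠ 0 := by nlinarith [hl.1, hl.2]
  fun_prop (disch := assumption)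

theorem sqrt_one_sub_sq_mem_Icc (l : ℝ) : √(1 - l ^ 2) ∈ Set.Icc (0:ℝ) 1 :=
  ⟨Real.sqrt_nonneg _, Real.sqrt_le_one.2 (by nlinarith [sq_nonneg l])⟩

theorem monotoneOn_pow_mul_exp {x : ℝ} (hx : 0 < x) (n : ℕ) :
    MonotoneOn (fun l : ℝ => l ^ n * Real.exp (-(√(1 - l ^ 2) * x))) (Set.Icc 0 1) :=
  fun u hu v hv huv => by
    have h0 := hu.1
    have h1 : 0 ≤ v ^ n := pow_nonneg hv.1 n
    have := antitoneOn_sqrt_one_sub_sq hu hv huv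
    dsimp only at this ⊢
    gcongr

/-- The weights `l ^ n * exp (-√(1 - l²) x)` at most double a uniform bound on primitives. -/
theorem norm_integral_pow_mul_exp_mul_le {x : ℝ} (hx : 0 < x) (n : ℕ) {g : ℝ → ℂ} {M : ℝ}
    (hg : Continuous g) (hM : ∀ c ∈ Set.Icc (0:ℝ) 1, ‖∫ u in (0:ℝ)..c, g u‖ ≤ M) :
    ∀ c ∈ Set.Icc (0:ℝ) 1, ‖∫ u in (0:ℝ)..c,
      ((u ^ n * Real.exp (-(√(1 - u ^ 2) * x)) : ℝ) : ℂ) * g u‖ ≤ 2 * M :=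
  norm_integral_unit_weight_mul_le (by fun_prop)
    (fun l hl => by
      have := differentiableAt_sqrt_one_sub_sq hl
      fun_prop)
    (Or.inl (monotoneOn_pow_mul_exp hx n))
    (fun l hl => ⟨mul_nonneg (pow_nonneg hl.1 n) (Real.exp_pos _).le,
      mul_le_one₀ (pow_le_one₀ hl.1 hl.2) (Real.exp_pos _).le (Real.exp_le_one_iff.2 (by
        have := Real.sqrt_nonneg (1 - l ^ 2)
        nlinarith))⟩) hg hM

/-- The half-interval estimate, for either sign of the imaginary part of the amplitude. -/
theorem norm_integral_half_le {x t : ℝ} (hx : 0 < x) (ht : t ≠ 0) (y : ℝ) {s : ℂ} (hs : ‖s‖ = 1) :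
    ‖∫ l in (0:ℝ)..1, (((l : ℂ) ^ 2 + s * l * (√(1 - l ^ 2) : ℂ))
        * Complex.exp (-((√(1 - l ^ 2) * x : ℝ) : ℂ)))
        * (Complex.exp (Complex.I * l * y) * Complex.exp (Complex.I * t * (l : ℂ) ^ 2))‖
      ≤ 24 * |t| ^ (-(1:ℝ)/2) := by
  set g : ℝ → ℂ := fun l =>
    Complex.exp (Complex.I * l * y) * Complex.exp (Complex.I * t * (l : ℂ) ^ 2) with hgdef
  have hg : Continuous g := by fun_prop
  have hM : ∀ c ∈ Set.Icc (0:ℝ) 1, ‖∫ u in (0:ℝ)..c, g u‖ ≤ 4 * |t| ^ (-(1:ℝ)/2) :=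
    fun c _ => norm_integral_quadratic_phase_le ht y c
  have h2 := norm_integral_pow_mul_exp_mul_le hx 2 hg hM 1 (by simp)
  have h1 := norm_integral_unit_weight_mul_le (by fun_prop)
    (fun l hl => differentiableAt_sqrt_one_sub_sq hl) (Or.inr antitoneOn_sqrt_one_sub_sq)
    (fun l _ => sqrt_one_sub_sq_mem_Icc l) (by fun_prop)
    (norm_integral_pow_mul_exp_mul_le hx 1 hg hM) 1 (by simp)
  have hsplit : ∀ l : ℝ, (((l : ℂ) ^ 2 + s * l * (√(1 - l ^ 2) : ℂ))
        * Complex.exp (-((√(1 - l ^ 2) * x : ℝ) : ℂ))) * g l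
      = ((l ^ 2 * Real.exp (-(√(1 - l ^ 2) * x)) : ℝ) : ℂ) * g l + s * ((√(1 - l ^ 2) : ℂ) *
        (((l ^ 1 * Real.exp (-(√(1 - l ^ 2) * x)) : ℝ) : ℂ) * g l)) := fun l => by
    push_cast
    ring
  rw [intervalIntegral.integral_congr fun l _ => hsplit l, intervalIntegral.integral_add
    (Continuous.intervalIntegrable (by fun_prop) _ _)
    (Continuous.intervalIntegrable (by fun_prop) _ _), intervalIntegral.integral_const_mul]
  refine (norm_add_le _ _).trans ?_
  rw [norm_mul, hs]
  linarith

/-- On `[-1, 1]` the point `l + i√(1 - l²)` lies on the unit circle, so dividing by it is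
multiplying by its conjugate. -/
theorem div_add_I_mul_sqrt {l : ℝ} (hl : l ∈ Set.Icc (-1:ℝ) 1) :
    (l : ℂ) / ((l : ℂ) + Complex.I * (√(1 - l ^ 2) : ℂ))
      = (l : ℂ) ^ 2 + -Complex.I * l * (√(1 - l ^ 2) : ℂ) := by
  have hsq : ((√(1 - l ^ 2) : ℝ) : ℂ) ^ 2 = 1 - (l : ℂ) ^ 2 := by
    rw [← Complex.ofReal_pow, Real.sq_sqrt (by nlinarith [hl.1, hl.2])]
    push_cast
    ring
  have hprod : ((l : ℂ) - Complex.I * (√(1 - l ^ 2) : ℂ)) *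
      ((l : ℂ) + Complex.I * (√(1 - l ^ 2) : ℂ)) = 1 := by
    linear_combination hsq - ((√(1 - l ^ 2) : ℝ) : ℂ) ^ 2 * Complex.I_sq
  rw [div_eq_iff (right_ne_zero_of_mul_eq_one hprod)]
  linear_combination -(l : ℂ) * hprod

/-- There is an absolute constant `C ≤ 120` such that for all `x, y > 0` and `t ≠ 0`,
`|∫_{−1}^{1} (λ/(λ+i√(1−λ²))) e^{−√(1−λ²)x} e^{iλy} e^{itλ²} dλ| ≤ C |t|^{−1/2}`. -/
theorem stmt5 : ∃ C : ℝ, C ≤ 120 ∧ ∀ x y t : ℝ, 0 < x → 0 < y → t ≠ 0 →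
    ‖∫ l in Set.Icc (-1:ℝ) 1,
        ((l : ℂ) / ((l : ℂ) + Complex.I * (Real.sqrt (1 - l ^ 2) : ℂ)))
          * Complex.exp (-((Real.sqrt (1 - l ^ 2) * x : ℝ) : ℂ))
          * Complex.exp (Complex.I * (l : ℂ) * (y : ℂ))
          * Complex.exp (Complex.I * (t : ℂ) * (l : ℂ) ^ 2)‖
      ≤ C * |t| ^ (-(1:ℝ)/2) := by
  refine ⟨48, by norm_num, fun x y t hx _ ht => ?_⟩
  set F : ℝ → ℂ := fun l => (((l : ℂ) ^ 2 + -Complex.I * l * (√(1 - l ^ 2) : ℂ))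
        * Complex.exp (-((√(1 - l ^ 2) * x : ℝ) : ℂ)))
        * (Complex.exp (Complex.I * l * y) * Complex.exp (Complex.I * t * (l : ℂ) ^ 2)) with hF
  have hFc : Continuous F := by fun_prop
  rw [setIntegral_congr_fun (g := F) measurableSet_Icc
      (fun l hl => by simp only [hF]; rw [div_add_I_mul_sqrt hl]; ring),
    integral_Icc_eq_integral_Ioc, ← intervalIntegral.integral_of_le (by norm_num),
    ← intervalIntegral.integral_add_adjacent_intervals (b := 0)
      (hFc.intervalIntegrable _ _) (hFc.intervalIntegrable _ _)]
  have hright : ‖∫ l in (0:ℝ)..1, F l‖ ≤ 24 * |t| ^ (-(1:ℝ)/2) :=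
    norm_integral_half_le hx ht y (by simp)
  have hleft : ‖∫ l in (-1:ℝ)..0, F l‖ ≤ 24 * |t| ^ (-(1:ℝ)/2) := by
    have hneg := intervalIntegral.integral_comp_neg (a := 0) (b := 1) F
    rw [neg_zero] at hneg
    rw [← hneg]
    convert norm_integral_half_le hx ht (-y) (s := Complex.I) (by simp) using 5 with l <;>
    · push_cast [neg_sq]
      ring_nf
  linarith [norm_add_le (∫ l in (-1:ℝ)..0, F l) (∫ l in (0:ℝ)..1, F l)]
end

section
/- There exists an absolute constant C such that for all A > 0, all M > 1 and all real t ≠ 0, |∫_0^∞ ((μ − ⟨μ⟩)/(μ + ⟨μ⟩)) e^{itμ²} e^{iμA} χ(⟨μ⟩/M) dμ| ≤ C |t|^{−1/2}. -/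
open MeasureTheory Complex

/-- The primitive `x ↦ ∫₀ˣ e^{itu²} du` of the quadratic phase. -/
noncomputable def fresnelIntegral (t x : ℝ) : ℂ := ∫ u in (0:ℝ)..x, exp (I * t * (u : ℂ) ^ 2)

lemma norm_exp_I_mul_sq (t u : ℝ) : ‖exp (I * t * (u : ℂ) ^ 2)‖ = 1 := by
  have h : I * t * (u : ℂ) ^ 2 = ((t * u ^ 2 : ℝ) : ℂ) * I := by push_cast; ring
  rw [h, norm_exp_ofReal_mul_I]

lemma hasDerivAt_fresnelIntegral (t x : ℝ) :
    HasDerivAt (fresnelIntegral t) (exp (I * t * (x : ℂ) ^ 2)) x := by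
  have hc : Continuous fun u : ℝ => exp (I * t * (u : ℂ) ^ 2) := by fun_prop
  exact intervalIntegral.integral_hasDerivAt_right (hc.intervalIntegrable _ _)
    (hc.stronglyMeasurableAtFilter _ _) hc.continuousAt

lemma fresnelIntegral_neg (t x : ℝ) : fresnelIntegral t (-x) = -fresnelIntegral t x := by
  have h := intervalIntegral.integral_comp_neg (a := 0) (b := x)
    (fun u : ℝ => exp (I * t * (u : ℂ) ^ 2))
  simp only [ofReal_neg, neg_sq, neg_zero] at h
  rw [fresnelIntegral, fresnelIntegral, h, intervalIntegral.integral_symm]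

lemma norm_fresnelIntegral_le_abs (t x : ℝ) : ‖fresnelIntegral t x‖ ≤ |x| := by
  have h := intervalIntegral.norm_integral_le_of_norm_le_const (a := 0) (b := x) (C := 1)
    (f := fun u : ℝ => exp (I * t * (u : ℂ) ^ 2)) fun u _ => (norm_exp_I_mul_sq t u).le
  simpa [fresnelIntegral] using h

lemma norm_fresnelIntegral_le_of_le {t d x : ℝ} (hd : 0 < d) (htd : |t| * d ^ 2 = 1)
    (hx : d ≤ x) : ‖fresnelIntegral t x‖ ≤ 2 * d := by
  have ht : t ≠ 0 := by rintro rfl; simp at htd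
  have ht' : 0 < |t| := abs_pos.2 ht
  set P : ℝ → ℂ := fun u => exp (I * t * (u : ℂ) ^ 2) / (2 * I * t * u) with hP
  have hPnorm (u : ℝ) (hu : 0 < u) : ‖P u‖ = 1 / (2 * |t| * u) := by
    simp only [hP, norm_div, norm_exp_I_mul_sq, norm_mul, norm_I, norm_real, Real.norm_eq_abs,
      abs_of_pos hu, Complex.norm_ofNat, mul_one]
  have hW (u : ℝ) (hu : 0 < u) : HasDerivAt (fun u => fresnelIntegral t u - P u)
      (exp (I * t * (u : ℂ) ^ 2) / (2 * I * t * (u : ℂ) ^ 2)) u := by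
    have hu' : (u : ℂ) ≠ 0 := ofReal_ne_zero.2 hu.ne'
    have htc : (t : ℂ) ≠ 0 := ofReal_ne_zero.2 ht
    have hid : HasDerivAt (fun u : ℝ => (u : ℂ)) 1 u := ofRealCLM.hasDerivAt
    have hnum := ((hid.pow 2).const_mul (I * t)).cexp
    have hden := hid.const_mul (2 * I * t)
    have hne : 2 * I * t * (u : ℂ) ≠ 0 := by simp [hu', htc, I_ne_zero]
    refine ((hasDerivAt_fresnelIntegral t u).sub (hnum.div hden hne)).congr_deriv ?_
    simp only [Pi.pow_apply]
    field_simp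
    push_cast
    ring
  have hB (u : ℝ) (hu : 0 < u) : HasDerivAt (fun u => 2 * d - 1 / (2 * |t|) * u⁻¹)
      (1 / (2 * |t| * u ^ 2)) u := by
    refine (((hasDerivAt_inv hu.ne').const_mul (1 / (2 * |t|))).const_sub (2 * d)).congr_deriv ?_
    field_simp
  have hd' : 1 / (2 * |t| * d) = d / 2 := by
    field_simp
    linarith
  have hstart : ‖fresnelIntegral t d - P d‖ ≤ 2 * d - 1 / (2 * |t|) * d⁻¹ := by
    have h1 := norm_sub_le (fresnelIntegral t d) (P d)
    have h2 := norm_fresnelIntegral_le_abs t d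
    rw [hPnorm d hd, hd'] at h1
    rw [abs_of_pos hd] at h2
    have h3 : 1 / (2 * |t|) * d⁻¹ = d / 2 := by rw [← hd']; field_simp
    rw [h3]
    linarith
  have key := image_norm_le_of_norm_deriv_right_le_deriv_boundary'
    (f := fun u => fresnelIntegral t u - P u) (a := d) (b := x)
    (fun u hu => (hW u (hd.trans_le hu.1)).continuousAt.continuousWithinAt)
    (fun u hu => (hW u (hd.trans_le hu.1)).hasDerivWithinAt) hstart
    (fun u hu => (hB u (hd.trans_le hu.1)).continuousAt.continuousWithinAt)
    (fun u hu => (hB u (hd.trans_le hu.1)).hasDerivWithinAt)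
    (fun u _ => by
      simp only [norm_div, norm_exp_I_mul_sq, norm_mul, norm_I, norm_real, Real.norm_eq_abs,
        norm_pow, sq_abs, Complex.norm_ofNat, mul_one, le_refl])
    (Set.right_mem_Icc.2 hx)
  have hx0 : 0 < x := hd.trans_le hx
  have h1 := norm_add_le (fresnelIntegral t x - P x) (P x)
  rw [sub_add_cancel, hPnorm x hx0] at h1
  have h2 : 1 / (2 * |t|) * x⁻¹ = 1 / (2 * |t| * x) := by field_simp
  rw [h2] at key
  linarith

lemma norm_fresnelIntegral_le {t : ℝ} (ht : t ≠ 0) (x : ℝ) :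
    ‖fresnelIntegral t x‖ ≤ 2 * |t| ^ (-(1:ℝ)/2) := by
  have ht' : 0 < |t| := abs_pos.2 ht
  set d := |t| ^ (-(1:ℝ)/2) with hd
  have hd0 : 0 < d := Real.rpow_pos_of_pos ht' _
  have htd : |t| * d ^ 2 = 1 := by
    rw [hd, ← Real.rpow_natCast, ← Real.rpow_mul ht'.le]
    norm_num [Real.rpow_neg_one, ht'.ne']
  have habs : ‖fresnelIntegral t x‖ = ‖fresnelIntegral t |x|‖ := by
    rcases abs_choice x with h | h <;> simp [h, fresnelIntegral_neg]
  rcases le_total d |x| with h | h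
  · exact habs ▸ norm_fresnelIntegral_le_of_le hd0 htd h
  · linarith [norm_fresnelIntegral_le_abs t x]

/-- The quadratic phase `e^{i(tμ² + Aμ)}` has a primitive bounded by `2 |t|^{-1/2}`. -/
lemma exists_bounded_primitive_quadratic_phase {t : ℝ} (ht : t ≠ 0) (A : ℝ) :
    ∃ F : ℝ → ℂ, (∀ x, ‖F x‖ ≤ 2 * |t| ^ (-(1:ℝ)/2)) ∧
      ∀ x : ℝ, HasDerivAt F (exp (I * t * (x : ℂ) ^ 2) * exp (I * x * A)) x := by
  refine ⟨fun x => exp ((-(A ^ 2 / (4 * t)) : ℝ) * I) * fresnelIntegral t (x + A / (2 * t)),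
    fun x => ?_, fun x => ?_⟩
  · rw [norm_mul, norm_exp_ofReal_mul_I, one_mul]
    exact norm_fresnelIntegral_le ht _
  · have htc : (t : ℂ) ≠ 0 := ofReal_ne_zero.2 ht
    refine (((hasDerivAt_fresnelIntegral t (x + A / (2 * t))).comp_add_const x
      (A / (2 * t))).const_mul (exp ((-(A ^ 2 / (4 * t)) : ℝ) * I))).congr_deriv ?_
    rw [← exp_add, ← exp_add]
    congr 1
    push_cast
    field_simp
    ring

/-- Van der Corput's estimate for a quadratic phase with an amplitude of bounded variation. -/
lemma norm_integral_mul_quadratic_phase_le {a a' b : ℝ → ℝ} {N t : ℝ} (hN : 0 ≤ N) (ht : t ≠ 0)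
    (A : ℝ) (ha : ∀ x, HasDerivAt a (a' x) x) (hc : Continuous a') (haN : a N = 0)
    (hb : ∀ x ∈ Set.Ioc 0 N, |a' x| ≤ b x) (hbi : IntervalIntegrable b volume 0 N) :
    ‖∫ x in (0:ℝ)..N, (a x : ℂ) * (exp (I * t * (x : ℂ) ^ 2) * exp (I * x * A))‖
      ≤ 2 * |t| ^ (-(1:ℝ)/2) * (|a 0| + ∫ x in (0:ℝ)..N, b x) := by
  obtain ⟨F, hF, hF'⟩ := exists_bounded_primitive_quadratic_phase ht A
  have hphase : Continuous fun x : ℝ => exp (I * t * (x : ℂ) ^ 2) * exp (I * x * A) := by fun_prop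
  have hparts := intervalIntegral.integral_mul_deriv_eq_deriv_mul
    (u := fun x => (a x : ℂ)) (v := F) (a := 0) (b := N)
    (fun x _ => (ha x).ofReal_comp) (fun x _ => hF' x)
    ((continuous_ofReal.comp hc).intervalIntegrable _ _) (hphase.intervalIntegrable _ _)
  have hint : ‖∫ x in (0:ℝ)..N, (a' x : ℂ) * F x‖
      ≤ ∫ x in (0:ℝ)..N, b x * (2 * |t| ^ (-(1:ℝ)/2)) := by
    refine intervalIntegral.norm_integral_le_of_norm_le hN
      (Filter.Eventually.of_forall fun x hx => ?_) (hbi.mul_const _)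
    rw [norm_mul, norm_real, Real.norm_eq_abs]
    exact mul_le_mul (hb x hx) (hF x) (norm_nonneg _) ((abs_nonneg _).trans (hb x hx))
  rw [intervalIntegral.integral_mul_const] at hint
  have h0 : ‖(a 0 : ℂ) * F 0‖ ≤ |a 0| * (2 * |t| ^ (-(1:ℝ)/2)) := by
    rw [norm_mul, norm_real, Real.norm_eq_abs]
    exact mul_le_mul_of_nonneg_left (hF 0) (abs_nonneg _)
  rw [hparts, haN, ofReal_zero, zero_mul, zero_sub]
  refine (norm_sub_le _ _).trans ?_
  rw [norm_neg]
  linarith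

lemma hasDerivAt_sqrt_one_add_sq (x : ℝ) :
    HasDerivAt (fun x : ℝ => √(1 + x ^ 2)) (x / √(1 + x ^ 2)) x := by
  have h : (1 + x ^ 2 : ℝ) ≠ 0 := by positivity
  refine ((((hasDerivAt_id' x).pow 2).const_add 1).sqrt h).congr_deriv ?_
  simp only [Pi.pow_apply]
  field_simp
  simp

lemma sub_sqrt_div_add_sqrt (x : ℝ) : (x - √(1 + x ^ 2)) / (x + √(1 + x ^ 2)) =
    2 * x * √(1 + x ^ 2) - 1 - 2 * x ^ 2 := by
  have hs : √(1 + x ^ 2) ^ 2 = 1 + x ^ 2 := Real.sq_sqrt (by positivity)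
  have hne : x + √(1 + x ^ 2) ≠ 0 := by
    intro h
    have h0 : (x + √(1 + x ^ 2)) * (x - √(1 + x ^ 2)) = 0 := by rw [h, zero_mul]
    nlinarith
  rw [div_eq_iff hne]
  linear_combination (-2 * x) * hs

lemma hasDerivAt_sub_sqrt_div_add_sqrt (x : ℝ) :
    HasDerivAt (fun x : ℝ => (x - √(1 + x ^ 2)) / (x + √(1 + x ^ 2)))
      (2 * (√(1 + x ^ 2) - x) ^ 2 / √(1 + x ^ 2)) x := by
  have hs : √(1 + x ^ 2) ^ 2 = 1 + x ^ 2 := Real.sq_sqrt (by positivity)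
  have hpos : 0 < √(1 + x ^ 2) := Real.sqrt_pos.2 (by positivity)
  simp only [sub_sqrt_div_add_sqrt]
  refine (((((hasDerivAt_id' x).const_mul 2).mul (hasDerivAt_sqrt_one_add_sq x)).sub_const 1).sub
    (((hasDerivAt_id' x).pow 2).const_mul 2)).congr_deriv ?_
  field_simp
  ring

lemma abs_sub_sqrt_div_add_sqrt_le {x : ℝ} (hx : 0 ≤ x) :
    |(x - √(1 + x ^ 2)) / (x + √(1 + x ^ 2))| ≤ 1 := by
  have hpos : 0 < √(1 + x ^ 2) := Real.sqrt_pos.2 (by positivity)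
  rw [abs_div, abs_of_pos (by positivity : 0 < x + √(1 + x ^ 2)), div_le_one (by positivity),
    abs_le]
  constructor <;> linarith

lemma sub_sqrt_div_add_sqrt_nonpos {x : ℝ} (hx : 0 ≤ x) :
    (x - √(1 + x ^ 2)) / (x + √(1 + x ^ 2)) ≤ 0 := by
  have h : x ≤ √(1 + x ^ 2) := Real.le_sqrt_of_sq_le (by linarith)
  exact div_nonpos_of_nonpos_of_nonneg (by linarith) (by positivity)

/-- There is an absolute constant `C` such that for all `A > 0`, `M > 1` and `t ≠ 0`,
`|∫_0^∞ ((μ−⟨μ⟩)/(μ+⟨μ⟩)) e^{itμ²} e^{iμA} χ(⟨μ⟩/M) dμ| ≤ C |t|^{−1/2}`,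
where `⟨μ⟩ = √(1+μ²)`. -/
theorem stmt7 (χ : ℝ → ℝ)
    (hχs : ContDiff ℝ (⊤ : ℕ∞) χ) (hχsupp : HasCompactSupport χ) (hχeven : ∀ l : ℝ, χ (-l) = χ l)
    (hχone : ∀ l : ℝ, |l| ≤ 4 → χ l = 1) (hχzero : ∀ l : ℝ, 8 ≤ |l| → χ l = 0)
    (hχd1 : ∀ l : ℝ, |deriv χ l| ≤ 1) (hχd2 : ∀ l : ℝ, |deriv (deriv χ) l| ≤ 1) :
    ∃ C : ℝ, ∀ A M t : ℝ, 0 < A → 1 < M → t ≠ 0 →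
      ‖∫ μ in Set.Ioi (0:ℝ),
          (((μ - Real.sqrt (1 + μ ^ 2)) / (μ + Real.sqrt (1 + μ ^ 2))
              * χ (Real.sqrt (1 + μ ^ 2) / M) : ℝ) : ℂ)
            * Complex.exp (Complex.I * (t : ℂ) * (μ : ℂ) ^ 2)
            * Complex.exp (Complex.I * (μ : ℂ) * (A : ℂ))‖
        ≤ C * |t| ^ (-(1:ℝ)/2) := by
  obtain ⟨K, hK⟩ := hχsupp.exists_bound_of_continuous hχs.continuous
  simp only [Real.norm_eq_abs] at hK
  have hK0 : 0 ≤ K := (abs_nonneg _).trans (hK 0)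
  refine ⟨2 * (K + (K + 8)), fun A M t _ hM ht => ?_⟩
  have hM0 : 0 < M := by linarith
  have hN : 0 ≤ 8 * M := by positivity
  have hspos (x : ℝ) : 0 < √(1 + x ^ 2) := Real.sqrt_pos.2 (by positivity)
  set g : ℝ → ℝ := fun x => (x - √(1 + x ^ 2)) / (x + √(1 + x ^ 2)) with hg
  set g' : ℝ → ℝ := fun x => 2 * (√(1 + x ^ 2) - x) ^ 2 / √(1 + x ^ 2) with hg'
  set h : ℝ → ℝ := fun x => χ (√(1 + x ^ 2) / M) with hh
  set h' : ℝ → ℝ := fun x => deriv χ (√(1 + x ^ 2) / M) * (x / √(1 + x ^ 2) / M) with hh'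
  have hgd (x : ℝ) : HasDerivAt g (g' x) x := hasDerivAt_sub_sqrt_div_add_sqrt x
  have hhd (x : ℝ) : HasDerivAt h (h' x) x :=
    ((hχs.differentiable (by simp) _).hasDerivAt).comp x
      ((hasDerivAt_sqrt_one_add_sq x).div_const M)
  have hgc : Continuous g := continuous_iff_continuousAt.2 fun x => (hgd x).continuousAt
  have hhc : Continuous h := continuous_iff_continuousAt.2 fun x => (hhd x).continuousAt
  have hg'c : Continuous g' :=
    Continuous.div (by fun_prop) (by fun_prop) fun x => (hspos x).ne'
  have hh'c : Continuous h' := by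
    have h1 : Continuous (deriv χ) := hχs.continuous_deriv (by simp)
    have h2 : Continuous fun x : ℝ => x / √(1 + x ^ 2) :=
      Continuous.div (by fun_prop) (by fun_prop) fun x => (hspos x).ne'
    exact (h1.comp (by fun_prop)).mul (h2.div_const M)
  have hzero (x : ℝ) (hx : 8 * M ≤ x) : h x = 0 := by
    refine hχzero _ ?_
    rw [abs_of_pos (div_pos (hspos x) hM0), le_div_iff₀ hM0]
    exact hx.trans (Real.le_sqrt_of_sq_le (by linarith))
  have hbound (x : ℝ) (hx : x ∈ Set.Ioc 0 (8 * M)) :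
      |g' x * h x + g x * h' x| ≤ g' x * K + 1 / M := by
    have hg'0 : 0 ≤ g' x := by have := hspos x; simp only [hg']; positivity
    have hr : |x / √(1 + x ^ 2) / M| ≤ 1 / M := by
      rw [abs_of_nonneg (div_nonneg (div_nonneg hx.1.le (hspos x).le) hM0.le)]
      refine div_le_div_of_nonneg_right ((div_le_one (hspos x)).2 ?_) hM0.le
      exact Real.le_sqrt_of_sq_le (by linarith)
    have hh'b : |h' x| ≤ 1 / M := by
      rw [hh', abs_mul]
      exact (mul_le_mul (hχd1 _) hr (abs_nonneg _) zero_le_one).trans_eq (one_mul _)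
    have h1 : |g' x * h x| ≤ g' x * K := by
      rw [abs_mul, abs_of_nonneg hg'0]
      exact mul_le_mul_of_nonneg_left (hK _) hg'0
    have h2 : |g x * h' x| ≤ 1 / M := by
      rw [abs_mul]
      exact (mul_le_mul (abs_sub_sqrt_div_add_sqrt_le hx.1.le) hh'b (abs_nonneg _)
        zero_le_one).trans_eq (one_mul _)
    exact (abs_add_le _ _).trans (add_le_add h1 h2)
  have hbi : IntervalIntegrable (fun x => g' x * K + 1 / M) volume 0 (8 * M) :=
    (by fun_prop : Continuous fun x => g' x * K + 1 / M).intervalIntegrable _ _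
  have hvar : ∫ x in (0:ℝ)..(8 * M), (g' x * K + 1 / M) ≤ K + 8 := by
    rw [intervalIntegral.integral_add ((hg'c.intervalIntegrable _ _).mul_const K)
      (continuous_const.intervalIntegrable _ _), intervalIntegral.integral_mul_const,
      intervalIntegral.integral_eq_sub_of_hasDerivAt (fun x _ => hgd x)
        (hg'c.intervalIntegrable _ _), intervalIntegral.integral_const]
    have h1 : g (8 * M) ≤ 0 := sub_sqrt_div_add_sqrt_nonpos hN
    have h2 : g 0 = -1 := by simp [hg]
    have h3 : (8 * M - 0) • (1 / M) = 8 := by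
      rw [smul_eq_mul]
      field_simp
      ring
    rw [h2, h3]
    nlinarith
  have hmain := norm_integral_mul_quadratic_phase_le (a := fun x => g x * h x) hN ht A
    (fun x => (hgd x).mul (hhd x)) ((hg'c.mul hhc).add (hgc.mul hh'c))
    (by simp [hzero (8 * M) le_rfl]) hbound hbi
  have ha0 : |g 0 * h 0| ≤ K := by
    rw [abs_mul]
    exact (mul_le_mul (abs_sub_sqrt_div_add_sqrt_le le_rfl) (hK _) (abs_nonneg _)
      zero_le_one).trans_eq (one_mul _)
  rw [intervalIntegral.integral_of_le hN] at hmain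
  have hset : ∫ x in Set.Ioi (0:ℝ), ((g x * h x : ℝ) : ℂ) * exp (I * t * (x : ℂ) ^ 2)
        * exp (I * x * A) =
      ∫ x in Set.Ioc (0:ℝ) (8 * M), ((g x * h x : ℝ) : ℂ) *
        (exp (I * t * (x : ℂ) ^ 2) * exp (I * x * A)) := by
    simp only [mul_assoc]
    refine setIntegral_eq_of_subset_of_forall_sdiff_eq_zero measurableSet_Ioi
      Set.Ioc_subset_Ioi_self fun x hx => ?_
    have hx' : 8 * M ≤ x := by
      by_contra! hlt
      exact hx.2 ⟨hx.1, hlt.le⟩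
    simp [hzero x hx']
  rw [hset]
  refine hmain.trans ?_
  have hd : 0 ≤ |t| ^ (-(1:ℝ)/2) := by positivity
  calc _ ≤ 2 * |t| ^ (-(1:ℝ)/2) * (K + (K + 8)) := by gcongr
    _ = _ := by ring
end

section
/- There exists an absolute constant C such that for all A > 0 and all real t ≠ 0, |∫_0^1 ((μ − i(1−μ²)^{1/2})/(μ + i(1−μ²)^{1/2})) e^{−A(1−μ²)^{1/2}} e^{−itμ²} dμ| ≤ C |t|^{−1/2}. -/
open MeasureTheory Complex

lemma norm_exp_neg_I_mul_sq (t u : ℝ) :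
    ‖Complex.exp (-(Complex.I * (t : ℂ) * (u : ℂ) ^ 2))‖ = 1 := by
  have : -(Complex.I * (t : ℂ) * (u : ℂ) ^ 2) = ((-(t * u ^ 2) : ℝ) : ℂ) * Complex.I := by
    push_cast; ring
  rw [this, Complex.norm_exp_ofReal_mul_I]

lemma hasDerivAt_exp_neg_I_mul_sq (t u : ℝ) :
    HasDerivAt (fun v : ℝ => Complex.exp (-(Complex.I * (t : ℂ) * (v : ℂ) ^ 2)))
      (Complex.exp (-(Complex.I * (t : ℂ) * (u : ℂ) ^ 2)) * (-(2 * Complex.I * t * u))) u := by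
  have h := ((((hasDerivAt_id (u : ℂ)).pow 2).const_mul (Complex.I * (t : ℂ))).neg.cexp).comp_ofReal
  refine h.congr_deriv ?_
  simp
  ring

/-- The truncated Fresnel integral `∫_0^x e^{-itv²} dv`. -/
noncomputable def fresnel (t x : ℝ) : ℂ :=
  ∫ v in (0:ℝ)..x, Complex.exp (-(Complex.I * (t : ℂ) * (v : ℂ) ^ 2))

lemma hasDerivAt_fresnel (t x : ℝ) :
    HasDerivAt (fresnel t) (Complex.exp (-(Complex.I * (t : ℂ) * (x : ℂ) ^ 2))) x := by
  have hc : Continuous fun v : ℝ => Complex.exp (-(Complex.I * (t : ℂ) * (v : ℂ) ^ 2)) := by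
    fun_prop
  exact hc.integral_hasStrictDerivAt 0 x |>.hasDerivAt

lemma norm_fresnel_le_self (t : ℝ) {x : ℝ} (hx : 0 ≤ x) : ‖fresnel t x‖ ≤ x := by
  have := intervalIntegral.norm_integral_le_of_norm_le_const (a := 0) (b := x) (C := 1)
    (f := fun v : ℝ => Complex.exp (-(Complex.I * (t : ℂ) * (v : ℂ) ^ 2)))
    (fun v _ => (norm_exp_neg_I_mul_sq t v).le)
  simpa [fresnel, abs_of_nonneg hx] using this

lemma norm_fresnel_le {t δ x : ℝ} (hδ : 0 < δ) (htδ : |t| * δ ^ 2 = 1) (hx : 0 ≤ x) :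
    ‖fresnel t x‖ ≤ 2 * δ := by
  rcases le_total x δ with h | h
  · linarith [norm_fresnel_le_self t hx]
  have ht : t ≠ 0 := by rintro rfl; simp at htδ
  have ht' : 0 < |t| := abs_pos.2 ht
  have htc : (t : ℂ) ≠ 0 := by exact_mod_cast ht
  have hx0 : 0 < x := hδ.trans_le h
  have hcorr : ∀ u : ℝ, 0 < u →
      ‖Complex.exp (-(Complex.I * (t : ℂ) * (u : ℂ) ^ 2)) * (2 * Complex.I * t * u)⁻¹‖
        = (2 * |t|)⁻¹ * u⁻¹ := by
    intro u hu
    rw [norm_mul, norm_exp_neg_I_mul_sq]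
    simp [abs_of_pos hu]
    ring
  have hinv : 1 / (|t| * δ) = δ := by field_simp; linarith
  have hderiv : ∀ u : ℝ, 0 < u → HasDerivAt
      (fun v : ℝ => fresnel t v
        + Complex.exp (-(Complex.I * (t : ℂ) * (v : ℂ) ^ 2)) * (2 * Complex.I * t * v)⁻¹)
      (-(Complex.exp (-(Complex.I * (t : ℂ) * (u : ℂ) ^ 2)) * (2 * Complex.I * t * u ^ 2)⁻¹)) u := by
    intro u hu
    have huc : (u : ℂ) ≠ 0 := by exact_mod_cast hu.ne'
    have hne : 2 * Complex.I * (t : ℂ) * (u : ℂ) ≠ 0 := by simp [ht, hu.ne']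
    have h1 : HasDerivAt (fun v : ℝ => (2 * Complex.I * (t : ℂ) * (v : ℂ))⁻¹)
        (-(2 * Complex.I * (t : ℂ)) / (2 * Complex.I * (t : ℂ) * (u : ℂ)) ^ 2) u := by
      have := (((hasDerivAt_id (u : ℂ)).const_mul (2 * Complex.I * (t : ℂ))).inv hne).comp_ofReal
      simpa using this
    refine ((hasDerivAt_fresnel t u).add
      ((hasDerivAt_exp_neg_I_mul_sq t u).mul h1)).congr_deriv ?_
    have hI := Complex.I_ne_zero
    field_simp
    ring
  have hB : ∀ u : ℝ, 0 < u → HasDerivAt (fun u => δ + 1 / (|t| * δ) - (2 * |t|)⁻¹ * u⁻¹)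
      ((2 * |t|)⁻¹ * (u ^ 2)⁻¹) u := by
    intro u hu
    refine (((hasDerivAt_inv hu.ne').const_mul (2 * |t|)⁻¹).const_sub _).congr_deriv ?_
    ring
  have key := image_norm_le_of_norm_deriv_right_le_deriv_boundary' (a := δ) (b := x)
    (B := fun u => δ + 1 / (|t| * δ) - (2 * |t|)⁻¹ * u⁻¹)
    (B' := fun u => (2 * |t|)⁻¹ * (u ^ 2)⁻¹)
    (fun u hu => (hderiv u (hδ.trans_le hu.1)).continuousAt.continuousWithinAt)
    (fun u hu => (hderiv u (hδ.trans_le hu.1)).hasDerivWithinAt)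
    (by
      refine (norm_add_le _ _).trans ?_
      rw [hcorr δ hδ]
      have h1 := norm_fresnel_le_self t hδ.le
      have h2 : 1 / (|t| * δ) = 2 * ((2 * |t|)⁻¹ * δ⁻¹) := by field_simp
      linarith)
    (fun u hu => (hB u (hδ.trans_le hu.1)).continuousAt.continuousWithinAt)
    (fun u hu => (hB u (hδ.trans_le hu.1)).hasDerivWithinAt)
    ?_ (Set.right_mem_Icc.2 h)
  · have h3 := norm_sub_le (fresnel t x
        + Complex.exp (-(Complex.I * (t : ℂ) * (x : ℂ) ^ 2)) * (2 * Complex.I * t * x)⁻¹)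
        (Complex.exp (-(Complex.I * (t : ℂ) * (x : ℂ) ^ 2)) * (2 * Complex.I * t * x)⁻¹)
    rw [add_sub_cancel_right, hcorr x hx0] at h3
    linarith
  · intro u _
    rw [norm_neg, norm_mul, norm_exp_neg_I_mul_sq]
    simp [mul_comm]

lemma amplitude_cos {θ : ℝ} (hθ : 0 ≤ Real.sin θ) :
    ((Real.cos θ : ℂ) - Complex.I * (Real.sqrt (1 - Real.cos θ ^ 2) : ℂ))
      / ((Real.cos θ : ℂ) + Complex.I * (Real.sqrt (1 - Real.cos θ ^ 2) : ℂ))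
      = Complex.exp (-(2 * Complex.I * θ)) := by
  have hs : Real.sqrt (1 - Real.cos θ ^ 2) = Real.sin θ := by
    rw [← Real.abs_sin_eq_sqrt_one_sub_cos_sq, abs_of_nonneg hθ]
  have h1 : (Real.cos θ : ℂ) - Complex.I * (Real.sin θ : ℂ) = Complex.exp (-(θ * Complex.I)) := by
    rw [← neg_mul, Complex.exp_mul_I, Complex.cos_neg, Complex.sin_neg]
    push_cast; ring
  have h2 : (Real.cos θ : ℂ) + Complex.I * (Real.sin θ : ℂ) = Complex.exp (θ * Complex.I) := by
    rw [Complex.exp_mul_I]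
    push_cast; ring
  rw [hs, h1, h2, ← Complex.exp_sub]
  congr 1
  ring

lemma hasDerivAt_amplitude (A θ : ℝ) :
    HasDerivAt (fun φ : ℝ => Complex.exp (-(2 * Complex.I * φ) - ((A * Real.sin φ : ℝ) : ℂ)))
      (Complex.exp (-(2 * Complex.I * θ) - ((A * Real.sin θ : ℝ) : ℂ))
        * (-(2 * Complex.I) - ((A * Real.cos θ : ℝ) : ℂ))) θ := by
  have h1 : HasDerivAt (fun φ : ℝ => -(2 * Complex.I * (φ : ℂ))) (-(2 * Complex.I)) θ := by
    simpa using ((hasDerivAt_id (θ : ℂ)).const_mul (2 * Complex.I)).neg.comp_ofReal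
  exact (h1.sub (((Real.hasDerivAt_sin θ).const_mul A).ofReal_comp)).cexp

lemma norm_amplitude (A θ : ℝ) :
    ‖Complex.exp (-(2 * Complex.I * θ) - ((A * Real.sin θ : ℝ) : ℂ))‖
      = Real.exp (-(A * Real.sin θ)) := by
  rw [Complex.norm_exp]
  congr 1
  simp [-Complex.ofReal_mul, -Complex.ofReal_sin]

/-- There is an absolute constant `C` such that for all `A > 0` and `t ≠ 0`,
`|∫_0^1 ((μ−i√(1−μ²))/(μ+i√(1−μ²))) e^{−A√(1−μ²)} e^{−itμ²} dμ| ≤ C |t|^{−1/2}`. -/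
theorem stmt8 : ∃ C : ℝ, ∀ A t : ℝ, 0 < A → t ≠ 0 →
    ‖∫ μ in Set.Icc (0:ℝ) 1,
        (((μ : ℂ) - Complex.I * (Real.sqrt (1 - μ ^ 2) : ℂ))
            / ((μ : ℂ) + Complex.I * (Real.sqrt (1 - μ ^ 2) : ℂ)))
          * Complex.exp (-((A * Real.sqrt (1 - μ ^ 2) : ℝ) : ℂ))
          * Complex.exp (-(Complex.I * (t : ℂ) * (μ : ℂ) ^ 2))‖
      ≤ C * |t| ^ (-(1:ℝ)/2) := by
  refine ⟨2 * (Real.pi + 3), fun A t hA ht => ?_⟩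
  have ht' : 0 < |t| := abs_pos.2 ht
  set δ : ℝ := |t| ^ (-(1:ℝ)/2) with hδ_def
  have hδ : 0 < δ := Real.rpow_pos_of_pos ht' _
  have htδ : |t| * δ ^ 2 = 1 := by
    rw [hδ_def, ← Real.rpow_natCast, ← Real.rpow_mul ht'.le]
    norm_num
    rw [Real.rpow_neg_one, mul_inv_cancel₀ ht'.ne']
  set f : ℝ → ℂ := fun μ => (((μ : ℂ) - Complex.I * (Real.sqrt (1 - μ ^ 2) : ℂ))
            / ((μ : ℂ) + Complex.I * (Real.sqrt (1 - μ ^ 2) : ℂ)))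
          * Complex.exp (-((A * Real.sqrt (1 - μ ^ 2) : ℝ) : ℂ))
          * Complex.exp (-(Complex.I * (t : ℂ) * (μ : ℂ) ^ 2)) with hf
  have hfc : Continuous f := by
    have hne : ∀ μ : ℝ, (μ : ℂ) + Complex.I * (Real.sqrt (1 - μ ^ 2) : ℂ) ≠ 0 := by
      intro μ h
      have h1 := congrArg Complex.re h
      have h2 := congrArg Complex.im h
      simp at h1 h2
      subst h1
      simp at h2
    refine ((Continuous.div (by fun_prop) (by fun_prop) hne).mul (by fun_prop)).mul (by fun_prop)
  rw [MeasureTheory.integral_Icc_eq_integral_Ioc, ← intervalIntegral.integral_of_le zero_le_one]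
  set G : ℝ → ℂ := fun φ => Complex.exp (-(2 * Complex.I * φ) - ((A * Real.sin φ : ℝ) : ℂ))
    with hG
  have hΦ : ∀ θ ∈ Set.Icc 0 (Real.pi / 2), ‖fresnel t (Real.cos θ)‖ ≤ 2 * δ := fun θ hθ =>
    norm_fresnel_le hδ htδ (Real.cos_nonneg_of_mem_Icc ⟨by linarith [hθ.1, Real.pi_pos], hθ.2⟩)
  have hpi := Real.pi_pos
  have hsin : ∀ θ ∈ Set.Icc 0 (Real.pi / 2), 0 ≤ Real.sin θ := fun θ hθ =>
    Real.sin_nonneg_of_nonneg_of_le_pi hθ.1 (by linarith [hθ.2])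
  have hderiv : ∀ θ ∈ Set.Icc 0 (Real.pi / 2), HasDerivAt
      (fun φ : ℝ => -(∫ μ in (1:ℝ)..Real.cos φ, f μ) + G φ * fresnel t (Real.cos φ))
      (G θ * (-(2 * Complex.I) - ((A * Real.cos θ : ℝ) : ℂ)) * fresnel t (Real.cos θ)) θ := by
    intro θ hθ
    have h1 := (hfc.integral_hasStrictDerivAt 1 (Real.cos θ)).hasDerivAt.scomp θ
      (Real.hasDerivAt_cos θ)
    have h2 := (hasDerivAt_fresnel t (Real.cos θ)).scomp θ (Real.hasDerivAt_cos θ)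
    refine (h1.neg.add ((hasDerivAt_amplitude A θ).mul h2)).congr_deriv ?_
    have hfG : f (Real.cos θ)
        = G θ * Complex.exp (-(Complex.I * (t : ℂ) * (Real.cos θ : ℂ) ^ 2)) := by
      simp only [hf, hG]
      rw [amplitude_cos (hsin θ hθ), ← Real.abs_sin_eq_sqrt_one_sub_cos_sq,
        abs_of_nonneg (hsin θ hθ), ← Complex.exp_add, sub_eq_add_neg]
    rw [hfG]
    simp only [hG, Complex.real_smul, Function.comp]
    ring
  have key := image_norm_le_of_norm_deriv_right_le_deriv_boundary (a := 0) (b := Real.pi / 2)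
    (B := fun θ => 2 * δ * (2 * θ - Real.exp (-(A * Real.sin θ)) + 2))
    (B' := fun θ => 2 * δ * (2 + A * Real.cos θ * Real.exp (-(A * Real.sin θ))))
    (fun θ hθ => (hderiv θ hθ).continuousAt.continuousWithinAt)
    (fun θ hθ => (hderiv θ (Set.Ico_subset_Icc_self hθ)).hasDerivWithinAt)
    ?_ ?_ ?_ (Set.right_mem_Icc.2 (by positivity))
  · rw [Real.cos_pi_div_two, ← intervalIntegral.integral_symm] at key
    have h0 : fresnel t 0 = 0 := by simp [fresnel]
    rw [h0, mul_zero, add_zero] at key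
    refine key.trans ?_
    have := Real.exp_pos (-(A * Real.sin (Real.pi / 2)))
    nlinarith
  · have := hΦ 0 ⟨le_rfl, by positivity⟩
    simp at this
    simp [hG]
    linarith
  · intro θ
    have h1 := (((Real.hasDerivAt_sin θ).const_mul A).neg).exp
    refine (((((hasDerivAt_id θ).const_mul 2).sub h1).add_const 2).const_mul (2 * δ)).congr_deriv ?_
    simp only [Pi.neg_apply]
    ring
  · intro θ hθ
    have hθ' := Set.Ico_subset_Icc_self hθ
    have hcos : 0 ≤ Real.cos θ :=
      Real.cos_nonneg_of_mem_Icc ⟨by linarith [hθ.1], hθ.2.le⟩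
    have hE : Real.exp (-(A * Real.sin θ)) ≤ 1 :=
      Real.exp_le_one_iff.2 (neg_nonpos.2 (mul_nonneg hA.le (hsin θ hθ')))
    have hE0 := Real.exp_pos (-(A * Real.sin θ))
    have h1 : ‖-(2 * Complex.I) - ((A * Real.cos θ : ℝ) : ℂ)‖ ≤ 2 + A * Real.cos θ := by
      refine (norm_sub_le _ _).trans ?_
      rw [Complex.norm_real, Real.norm_of_nonneg (mul_nonneg hA.le hcos)]
      simp
    rw [norm_mul, norm_mul, norm_amplitude]
    calc _ ≤ Real.exp (-(A * Real.sin θ)) * (2 + A * Real.cos θ) * (2 * δ) := by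
          gcongr
          exact hΦ θ hθ'
      _ ≤ _ := by nlinarith
end
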